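/- arXiv:2307.10109 — 7 statements merged into one kernel-verified Lean document; each statement's English description precedes it below -/
import Mathlib

section
/- Let (X,d,μ) be a metric space equipped with a σ-finite Borel regular measure μ. Let (B_i)_{i∈ℕ} be a sequence of closed balls in X whose radii r(B_i) → 0 as i → ∞, and suppose there is a constant c_1 > 0 with μ(B_i) ≥ c_1·μ(5B_i) for every i ∈ ℕ. Let (U_i)_{i∈ℕ} be a sequence of μ-measurable subsets of X with U_i ⊆ B_i for each i and μ(U_i) ≥ c_2·μ(B_i) for some fixed constant c_2 > 0. Then μ(limsup_{i→∞} B_i \ limsup_{i→∞} U_i) = 0. -/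
open MeasureTheory Metric Filter
open scoped NNReal ENNReal

/-- Let `A` be a set disjoint from all the `U i`, `i ∈ t`, such that every point of `A` lies in
arbitrarily small balls `closedBall (x i) (r i)`, `i ∈ t`. If each `U i` occupies a fixed
proportion of the enlarged ball `closedBall (x i) (5 * r i)`, then every open neighbourhood of `A`
exceeds `A` by a fixed proportion of the measure of `A`. -/
lemma mul_measure_le_measure_diff_of_fine_cover
    {X : Type*} [MetricSpace X] [MeasurableSpace X] {μ : Measure X}
    {x : ℕ → X} {r : ℕ → ℝ} {U : ℕ → Set X} {c : ℝ≥0∞} {t : Set ℕ} {A W : Set X}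
    (hUmeas : ∀ i ∈ t, MeasurableSet (U i)) (hUsub : ∀ i ∈ t, U i ⊆ closedBall (x i) (r i))
    (hU : ∀ i ∈ t, c * μ (closedBall (x i) (5 * r i)) ≤ μ (U i))
    (hAU : ∀ i ∈ t, Disjoint A (U i))
    (hA : ∀ y ∈ A, ∀ ε > 0, ∃ i ∈ t, r i < ε ∧ y ∈ closedBall (x i) (r i))
    (hW : IsOpen W) (hAW : A ⊆ W) :
    c * μ A ≤ μ (W \ A) := by
  obtain ⟨u, hut, hdisj, hcov⟩ := Vitali.exists_disjoint_subfamily_covering_enlargement_closedBall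
    {i ∈ t | r i ≤ 1 ∧ closedBall (x i) (r i) ⊆ W} x r 1 (fun i hi => hi.2.1) 5 (by norm_num)
  have hAcov : A ⊆ ⋃ i ∈ u, closedBall (x i) (5 * r i) := by
    intro y hy
    obtain ⟨ε, hε, hεW⟩ := Metric.isOpen_iff.1 hW y (hAW hy)
    obtain ⟨i, hit, hri, hyi⟩ := hA y hy (min 1 (ε / 2)) (by positivity)
    have hiW : closedBall (x i) (r i) ⊆ W := by
      refine fun z hz => hεW ?_
      rw [mem_closedBall] at hz hyi
      rw [mem_ball]
      linarith [dist_triangle_right z y (x i), min_le_right 1 (ε / 2)]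
    obtain ⟨j, hj, hij⟩ := hcov i ⟨hit, (hri.trans_le (min_le_left _ _)).le, hiW⟩
    exact Set.mem_biUnion hj (hij hyi)
  calc c * μ A ≤ c * ∑' i : u, μ (closedBall (x i) (5 * r i)) := by
        gcongr
        exact (measure_mono hAcov).trans (measure_biUnion_le μ u.to_countable _)
    _ = ∑' i : u, c * μ (closedBall (x i) (5 * r i)) := ENNReal.tsum_mul_left.symm
    _ ≤ ∑' i : u, μ (U i) := ENNReal.tsum_le_tsum fun i => hU i (hut i.2).1
    _ = μ (⋃ i ∈ u, U i) :=
        (measure_biUnion u.to_countable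
          (fun i hi j hj hij => (hdisj hi hj hij).mono (hUsub i (hut hi).1) (hUsub j (hut hj).1))
          fun i hi => hUmeas i (hut hi).1).symm
    _ ≤ μ (W \ A) := measure_mono <| Set.iUnion₂_subset fun i hi => Set.subset_sdiff.2
        ⟨(hUsub i (hut hi).1).trans (hut hi).2.2, (hAU i (hut hi).1).symm⟩

/-- Lemma (CI for balls): let `μ` be a σ-finite Borel regular measure on a metric space,
`(B_i)` a sequence of closed balls with radii tending to `0` satisfying
`μ(B_i) ≥ c₁ μ(5B_i)`, and `(U_i)` measurable sets with `U_i ⊆ B_i` and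
`μ(U_i) ≥ c₂ μ(B_i)`.  Then `μ(limsup B_i \ limsup U_i) = 0`. -/
theorem limsup_balls_diff_limsup_subsets_null
    {X : Type*} [MetricSpace X] [MeasurableSpace X] [BorelSpace X]
    (μ : Measure X) [SigmaFinite μ] [μ.OuterRegular]
    (x : ℕ → X) (r : ℕ → ℝ) (hr : Tendsto r atTop (nhds 0))
    (c₁ : ℝ≥0) (hc₁ : 0 < c₁)
    (h₁ : ∀ i, (c₁ : ℝ≥0∞) * μ (closedBall (x i) (5 * r i)) ≤ μ (closedBall (x i) (r i)))
    (U : ℕ → Set X) (hUmeas : ∀ i, MeasurableSet (U i))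
    (hUsub : ∀ i, U i ⊆ closedBall (x i) (r i))
    (c₂ : ℝ≥0) (hc₂ : 0 < c₂)
    (h₂ : ∀ i, (c₂ : ℝ≥0∞) * μ (closedBall (x i) (r i)) ≤ μ (U i)) :
    μ ((⋂ N : ℕ, ⋃ i : ℕ, ⋃ _ : N ≤ i, closedBall (x i) (r i)) \
        ⋂ N : ℕ, ⋃ i : ℕ, ⋃ _ : N ≤ i, U i) = 0 := by
  set L : Set X := ⋂ N : ℕ, ⋃ i : ℕ, ⋃ _ : N ≤ i, closedBall (x i) (r i)
  rw [Set.sdiff_iInter, measure_iUnion_null_iff]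
  intro N
  have hc : (c₂ * c₁ : ℝ≥0∞) ≠ 0 := by positivity
  have hLmeas : MeasurableSet L := .iInter fun _ => .iUnion fun _ => .iUnion fun _ =>
    isClosed_closedBall.measurableSet
  have hmeas : MeasurableSet (L \ ⋃ i : ℕ, ⋃ _ : N ≤ i, U i) :=
    hLmeas.diff (.iUnion fun i => .iUnion fun _ => hUmeas i)
  rw [← Set.inter_univ (_ \ _), ← iUnion_spanningSets μ, Set.inter_iUnion, measure_iUnion_null_iff]
  intro k
  set A := (L \ ⋃ i : ℕ, ⋃ _ : N ≤ i, U i) ∩ spanningSets μ k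
  have hAmeas : MeasurableSet A := hmeas.inter (measurableSet_spanningSets μ k)
  have hAfin : μ A ≠ ∞ :=
    ((measure_mono Set.inter_subset_right).trans_lt (measure_spanningSets_lt_top μ k)).ne
  have hzero : (c₂ * c₁ : ℝ≥0∞) * μ A = 0 := by
    by_contra hne
    obtain ⟨W, hAW, hW, -, hlt⟩ := hAmeas.exists_isOpen_sdiff_lt hAfin hne
    refine hlt.not_ge (mul_measure_le_measure_diff_of_fine_cover (x := x) (r := r) (U := U)
      (t := Set.Ici N) (fun i _ => hUmeas i) (fun i _ => hUsub i) (fun i _ => ?_)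
      (fun i hi => ?_) (fun y hy ε hε => ?_) hW hAW)
    · rw [mul_assoc]
      exact (mul_le_mul_right (h₁ i) _).trans (h₂ i)
    · exact Set.disjoint_left.2 fun y hy hyU => hy.1.2 (Set.mem_iUnion₂.2 ⟨i, hi, hyU⟩)
    · obtain ⟨M, hM⟩ := eventually_atTop.1 (hr.eventually_lt_const hε)
      obtain ⟨i, hi, hyi⟩ := Set.mem_iUnion₂.1 (Set.mem_iInter.1 hy.1.1 (max N M))
      exact ⟨i, (le_max_left _ _).trans hi, hM i ((le_max_right _ _).trans hi), hyi⟩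
  exact (mul_eq_zero.1 hzero).resolve_left hc
end

section
/- Let (X,d,μ) be a metric space equipped with a σ-finite Borel regular measure μ. Let (B_i)_{i∈ℕ} be a sequence of balls in X with r(B_i) → 0 as i → ∞, and let 0 < c < C. Suppose there exists C' > C such that for each of the two pairs (δ,ρ) = (C, 5C') and (δ,ρ) = (c, C') there is a constant c(δ,ρ) > 0 with μ(δB_i) ≥ c(δ,ρ)·μ(ρB_i) for all i ∈ ℕ. Then μ(limsup_{i→∞} CB_i \ limsup_{i→∞} cB_i) = 0. -/
open MeasureTheory Metric Filter
open scoped NNReal ENNReal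

/-- A measurable set `A` of finite measure that is contained in the limsup of the balls `C B_i`
and disjoint from all `c B_i` with `i ≥ N` is null, provided the `c B_i` cover a definite proportion
of the balls `5C' B_i` for some `C' > C`. -/
theorem measure_eq_zero_of_forall_mem_ball_of_disjoint
    {X : Type*} [PseudoMetricSpace X] [MeasurableSpace X] [OpensMeasurableSpace X]
    (μ : Measure X) [μ.OuterRegular]
    {x : ℕ → X} {r : ℕ → ℝ} (hr : Tendsto r atTop (nhds 0))
    {c C C' : ℝ} (hC : 0 < C) (hcC' : c ≤ C') (hCC' : C < C') {K : ℝ≥0∞} (hK : K ≠ ∞)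
    (hμ : ∀ i, μ (ball (x i) (5 * C' * r i)) ≤ K * μ (ball (x i) (c * r i)))
    {A : Set X} (hA : MeasurableSet A) (hA' : μ A ≠ ∞) {N : ℕ}
    (hlim : ∀ y ∈ A, ∃ᶠ i in atTop, y ∈ ball (x i) (C * r i))
    (hdisj : ∀ i ≥ N, Disjoint (ball (x i) (c * r i)) A) :
    μ A = 0 := by
  have hC' : 0 < C' := hC.trans hCC'
  have key : ∀ ε : ℝ≥0∞, ε ≠ 0 → μ A ≤ K * ε := by
    intro ε hε
    obtain ⟨V, hAV, hVo, -, hVε⟩ := hA.exists_isOpen_sdiff_lt hA' hε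
    set t : Set ℕ := {i | N ≤ i ∧ 0 < r i ∧ r i ≤ 1 ∧ ball (x i) (C' * r i) ⊆ V}
    obtain ⟨u, hut, hu_disj, hu_cov⟩ :=
      Vitali.exists_disjoint_subfamily_covering_enlargement_ball t x (fun i => C' * r i) C'
        (fun i hi => mul_le_of_le_one_right hC'.le hi.2.2.1) 5 (by norm_num)
    have hsub : ∀ i ∈ u, ball (x i) (c * r i) ⊆ ball (x i) (C' * r i) := fun i hi =>
      ball_subset_ball (mul_le_mul_of_nonneg_right hcC' (hut hi).2.1.le)
    have hcov : A ⊆ ⋃ i ∈ u, ball (x i) (5 * C' * r i) := by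
      intro y hy
      obtain ⟨δ, hδ, hδV⟩ := Metric.isOpen_iff.1 hVo y (hAV hy)
      have hsmall : ∀ᶠ i in atTop, r i < min 1 (δ / (2 * C')) :=
        hr.eventually_lt_const (by positivity)
      obtain ⟨i, hyi, hri, hNi⟩ :=
        ((hlim y hy).and_eventually (hsmall.and (eventually_ge_atTop N))).exists
      have hpos : 0 < r i := pos_of_mul_pos_right (pos_of_mem_ball hyi) hC.le
      have hyi' : y ∈ ball (x i) (C' * r i) :=
        ball_subset_ball (mul_le_mul_of_nonneg_right hCC'.le hpos.le) hyi
      have hδi : r i * (2 * C') < δ :=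
        (lt_div_iff₀ (by positivity)).1 (hri.trans_le (min_le_right _ _))
      have hit : i ∈ t := by
        refine ⟨hNi, hpos, (hri.trans_le (min_le_left _ _)).le, fun z hz => hδV ?_⟩
        rw [mem_ball] at hz hyi' ⊢
        have := dist_triangle_right z y (x i)
        linarith
      obtain ⟨j, hj, hij⟩ := hu_cov i hit
      refine Set.mem_biUnion hj ?_
      rw [mul_assoc]
      exact hij hyi'
    calc μ A ≤ μ (⋃ i ∈ u, ball (x i) (5 * C' * r i)) := measure_mono hcov
      _ ≤ ∑' i : u, μ (ball (x i) (5 * C' * r i)) := measure_biUnion_le μ u.to_countable _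
      _ ≤ ∑' i : u, K * μ (ball (x i) (c * r i)) := ENNReal.tsum_le_tsum fun i => hμ i
      _ = K * μ (⋃ i ∈ u, ball (x i) (c * r i)) := by
        rw [ENNReal.tsum_mul_left, measure_biUnion u.to_countable
          (fun i hi j hj hij => (hu_disj hi hj hij).mono (hsub i hi) (hsub j hj))
          fun i _ => measurableSet_ball]
      _ ≤ K * μ (V \ A) := by
        gcongr
        exact Set.iUnion₂_subset fun i hi => Set.subset_sdiff.2
          ⟨(hsub i hi).trans (hut hi).2.2.2, hdisj i (hut hi).1⟩
      _ ≤ K * ε := by gcongr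
  have hlim0 : Tendsto (fun ε : ℝ≥0∞ => K * ε) (nhdsWithin 0 {0}ᶜ) (nhds 0) := by
    have := (ENNReal.continuous_const_mul hK).tendsto 0
    rw [mul_zero] at this
    exact this.mono_left nhdsWithin_le_nhds
  exact le_antisymm (ge_of_tendsto hlim0 (eventually_mem_nhdsWithin.mono key)) zero_le

/-- Corollary (CI for scaled balls): let `μ` be a σ-finite Borel regular measure on a
metric space and `(B_i) = (B(x_i, r_i))` a sequence of balls with radii tending to `0`.
Let `0 < c < C` and suppose there is `C' > C` such that for each of the two pairs
`(δ, ρ) = (C, 5C')` and `(δ, ρ) = (c, C')` there is a constant `c(δ,ρ) > 0` with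
`μ(δ B_i) ≥ c(δ,ρ) μ(ρ B_i)` for all `i`.  Then
`μ(limsup C·B_i \ limsup c·B_i) = 0`. -/
theorem limsup_scaled_balls_diff_null
    {X : Type*} [MetricSpace X] [MeasurableSpace X] [BorelSpace X]
    (μ : Measure X) [SigmaFinite μ] [μ.OuterRegular]
    (x : ℕ → X) (r : ℕ → ℝ) (hr : Tendsto r atTop (nhds 0))
    (c C C' : ℝ) (hc : 0 < c) (hcC : c < C) (hCC' : C < C')
    (h₁ : ∃ κ : ℝ≥0, 0 < κ ∧ ∀ i,
      (κ : ℝ≥0∞) * μ (ball (x i) (5 * C' * r i)) ≤ μ (ball (x i) (C * r i)))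
    (h₂ : ∃ κ : ℝ≥0, 0 < κ ∧ ∀ i,
      (κ : ℝ≥0∞) * μ (ball (x i) (C' * r i)) ≤ μ (ball (x i) (c * r i))) :
    μ ((⋂ N : ℕ, ⋃ i : ℕ, ⋃ _ : N ≤ i, ball (x i) (C * r i)) \
        ⋂ N : ℕ, ⋃ i : ℕ, ⋃ _ : N ≤ i, ball (x i) (c * r i)) = 0 := by
  obtain ⟨κ₁, hκ₁, h₁⟩ := h₁
  obtain ⟨κ₂, hκ₂, h₂⟩ := h₂
  have hC : 0 < C := hc.trans hcC
  have hκ₁' : (κ₁ : ℝ≥0∞) ≠ 0 := by exact_mod_cast hκ₁.ne'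
  have hκ₂' : (κ₂ : ℝ≥0∞) ≠ 0 := by exact_mod_cast hκ₂.ne'
  have hμ : ∀ i, μ (ball (x i) (5 * C' * r i)) ≤
      (κ₁ : ℝ≥0∞)⁻¹ * (κ₂ : ℝ≥0∞)⁻¹ * μ (ball (x i) (c * r i)) := by
    intro i
    have hball : ball (x i) (C * r i) ⊆ ball (x i) (C' * r i) := by
      rcases le_total (r i) 0 with hri | hri
      · rw [ball_eq_empty.2 (mul_nonpos_of_nonneg_of_nonpos hC.le hri)]
        exact Set.empty_subset _
      · exact ball_subset_ball (mul_le_mul_of_nonneg_right hCC'.le hri)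
    calc μ (ball (x i) (5 * C' * r i)) ≤ (κ₁ : ℝ≥0∞)⁻¹ * μ (ball (x i) (C * r i)) :=
          (ENNReal.mul_le_iff_le_inv hκ₁' ENNReal.coe_ne_top).1 (h₁ i)
      _ ≤ (κ₁ : ℝ≥0∞)⁻¹ * μ (ball (x i) (C' * r i)) := by gcongr
      _ ≤ (κ₁ : ℝ≥0∞)⁻¹ * ((κ₂ : ℝ≥0∞)⁻¹ * μ (ball (x i) (c * r i))) := by
        gcongr
        exact (ENNReal.mul_le_iff_le_inv hκ₂' ENNReal.coe_ne_top).1 (h₂ i)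
      _ = _ := (mul_assoc _ _ _).symm
  have hmeas : ∀ (ρ : ℝ) (N : ℕ), MeasurableSet (⋃ i : ℕ, ⋃ _ : N ≤ i, ball (x i) (ρ * r i)) :=
    fun ρ N => .iUnion fun i => .iUnion fun _ => measurableSet_ball
  rw [Set.sdiff_iInter, measure_iUnion_null_iff]
  intro N
  rw [← Set.inter_univ (_ \ _), ← iUnion_spanningSets μ, Set.inter_iUnion,
    measure_iUnion_null_iff]
  intro n
  refine measure_eq_zero_of_forall_mem_ball_of_disjoint μ hr (N := N) hC (hcC.trans hCC').le hCC'
    (ENNReal.mul_ne_top (ENNReal.inv_ne_top.2 hκ₁') (ENNReal.inv_ne_top.2 hκ₂')) hμ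
    (((MeasurableSet.iInter fun M => hmeas C M).diff (hmeas c N)).inter
      (measurableSet_spanningSets μ n))
    (measure_ne_top_of_subset Set.inter_subset_right (measure_spanningSets_lt_top μ n).ne)
    (fun y hy => frequently_atTop.2 fun M => ?_) fun i hi => ?_
  · obtain ⟨i, hMi, hyi⟩ := Set.mem_iUnion₂.1 (Set.mem_iInter.1 hy.1.1 M)
    exact ⟨i, hMi, hyi⟩
  · exact Set.disjoint_left.2 fun y hyi hy => hy.1.2 (Set.mem_iUnion₂.2 ⟨i, hi, hyi⟩)
end

section
/- Let (X,d,μ) be a metric space equipped with a σ-finite doubling Borel regular measure μ. Let (B_i)_{i∈ℕ} be a sequence of balls in X centred at points of supp μ with r(B_i) → 0 as i → ∞. Then for any 0 < c < C one has μ(limsup_{i→∞} CB_i \ limsup_{i→∞} cB_i) = 0. -/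
open MeasureTheory Metric Filter
open scoped NNReal ENNReal

/-- The (topological) support of a measure on a metric space. -/
def measSupport {X : Type*} [MetricSpace X] [MeasurableSpace X] (μ : Measure X) : Set X :=
  {x | ∀ r : ℝ, 0 < r → 0 < μ (ball x r)}

/-- A measure `μ` on a metric space is *doubling* if there are `λ > 0` and `r₀ > 0` such
that `μ(B(x,2r)) ≤ λ · μ(B(x,r))` for every `x ∈ supp μ` and every `0 < r < r₀`. -/
def IsDoublingMeasure {X : Type*} [MetricSpace X] [MeasurableSpace X] (μ : Measure X) : Prop :=
  ∃ (lam : ℝ≥0) (r₀ : ℝ), 0 < lam ∧ 0 < r₀ ∧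
    ∀ x ∈ measSupport μ, ∀ r : ℝ, 0 < r → r < r₀ →
      μ (ball x (2 * r)) ≤ (lam : ℝ≥0∞) * μ (ball x r)

/-- Iterating the doubling inequality. -/
theorem measure_ball_two_pow_mul_le {X : Type*} [MetricSpace X] [MeasurableSpace X]
    {μ : Measure X} {lam : ℝ≥0} {r₀ : ℝ} {y : X}
    (h : ∀ s : ℝ, 0 < s → s < r₀ → μ (ball y (2 * s)) ≤ (lam : ℝ≥0∞) * μ (ball y s))
    (k : ℕ) {s : ℝ} (hs : 0 < s) (hsr : 2 ^ k * s < r₀) :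
    μ (ball y (2 ^ k * s)) ≤ (lam : ℝ≥0∞) ^ k * μ (ball y s) := by
  induction k with
  | zero => simp
  | succ k ih =>
    have hpos : 0 < 2 ^ k * s := by positivity
    rw [pow_succ', mul_assoc] at hsr
    have hlt : 2 ^ k * s < r₀ := by linarith
    calc μ (ball y (2 ^ (k + 1) * s)) = μ (ball y (2 * (2 ^ k * s))) := by
          rw [pow_succ', mul_assoc]
      _ ≤ lam * μ (ball y (2 ^ k * s)) := h _ hpos hlt
      _ ≤ lam * ((lam : ℝ≥0∞) ^ k * μ (ball y s)) := by gcongr; exact ih hlt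
      _ = (lam : ℝ≥0∞) ^ (k + 1) * μ (ball y s) := by rw [pow_succ', mul_assoc]

/-- Let `W` be a measurable set of finite measure, each point of which lies in infinitely many of
the balls `B(x_i, C r_i)`. If eventually `B(x_i, c r_i)` is disjoint from `W` and has measure
comparable to that of `B(x_i, 5 C r_i)`, then `W` is null. -/
theorem measure_eq_zero_of_frequently_mem_ball {X : Type*} [MetricSpace X] [MeasurableSpace X]
    [BorelSpace X] {μ : Measure X} [μ.OuterRegular] {x : ℕ → X} {r : ℕ → ℝ}
    (hr : Tendsto r atTop (nhds 0)) {c C : ℝ} (hc : 0 < c) (hcC : c < C) {K : ℝ≥0} {W : Set X}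
    (hWm : MeasurableSet W) (hWfin : μ W ≠ ∞)
    (hWmem : ∀ p ∈ W, ∃ᶠ i in atTop, p ∈ ball (x i) (C * r i))
    (hWdisj : ∀ᶠ i in atTop, Disjoint (ball (x i) (c * r i)) W)
    (hK : ∀ᶠ i in atTop, 0 < r i →
      μ (ball (x i) (5 * (C * r i))) ≤ K * μ (ball (x i) (c * r i))) :
    μ W = 0 := by
  have hC : 0 < C := hc.trans hcC
  suffices H : ∀ ε : ℝ≥0, 0 < ε → μ W ≤ K * ε by
    have hlim : Tendsto (fun ε : ℝ≥0 => (K : ℝ≥0∞) * ε) (nhdsWithin 0 (Set.Ioi 0)) (nhds 0) := by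
      have hcont : Continuous fun ε : ℝ≥0 => ((K * ε : ℝ≥0) : ℝ≥0∞) := by fun_prop
      have h0 := hcont.tendsto 0
      simp only [mul_zero, ENNReal.coe_zero, ENNReal.coe_mul] at h0
      exact h0.mono_left nhdsWithin_le_nhds
    exact le_antisymm (ge_of_tendsto hlim (eventually_nhdsWithin_of_forall H)) zero_le
  intro ε hε
  obtain ⟨O, hWO, hO, -, hOW⟩ :=
    hWm.exists_isOpen_sdiff_lt hWfin (ENNReal.coe_ne_zero.2 hε.ne')
  have hCr : Tendsto (fun i => C * r i) atTop (nhds 0) := by simpa using hr.const_mul C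
  let t : Set ℕ := {i | 0 < r i ∧ C * r i ≤ 1 ∧ ball (x i) (C * r i) ⊆ O ∧
    Disjoint (ball (x i) (c * r i)) W ∧
    μ (ball (x i) (5 * (C * r i))) ≤ K * μ (ball (x i) (c * r i))}
  have hcover : W ⊆ ⋃ i ∈ t, ball (x i) (C * r i) := by
    intro p hp
    obtain ⟨δ, hδ, hpO⟩ := Metric.isOpen_iff.1 hO p (hWO hp)
    obtain ⟨i, hpi, hdisj, hKi, h1, h2⟩ := ((hWmem p hp).and_eventually
      (hWdisj.and (hK.and ((hCr.eventually_le_const one_pos).and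
        (hCr.eventually_lt_const (half_pos hδ)))))).exists
    have hri : 0 < r i := pos_of_mul_pos_right (pos_of_mem_ball hpi) hC.le
    refine Set.mem_biUnion (x := i) ⟨hri, h1, ?_, hdisj, hKi hri⟩ hpi
    refine (ball_subset_ball' ?_).trans hpO
    rw [mem_ball'] at hpi
    linarith
  obtain ⟨u, hut, hudisj, hu⟩ := Vitali.exists_disjoint_subfamily_covering_enlargement_ball t x
    (fun i => C * r i) 1 (fun i hi => hi.2.1) 5 (by norm_num)
  have hsub : ∀ i ∈ u, ball (x i) (c * r i) ⊆ ball (x i) (C * r i) := fun i hi =>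
    ball_subset_ball (mul_le_mul_of_nonneg_right hcC.le (hut hi).1.le)
  have hudisj' : u.PairwiseDisjoint fun i => ball (x i) (c * r i) := fun i hi j hj hij =>
    (hudisj hi hj hij).mono (hsub i hi) (hsub j hj)
  calc μ W ≤ μ (⋃ i ∈ u, ball (x i) (5 * (C * r i))) := by
        refine measure_mono (hcover.trans (Set.iUnion₂_subset fun i hi => ?_))
        obtain ⟨j, hj, hij⟩ := hu i hi
        exact hij.trans (Set.subset_biUnion_of_mem (u := fun j => ball (x j) (5 * (C * r j))) hj)
    _ ≤ ∑' i : u, μ (ball (x i) (5 * (C * r i))) := measure_biUnion_le μ u.to_countable _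
    _ ≤ ∑' i : u, K * μ (ball (x i) (c * r i)) :=
        ENNReal.tsum_le_tsum fun i => (hut i.2).2.2.2.2
    _ = K * μ (⋃ i ∈ u, ball (x i) (c * r i)) := by
        rw [ENNReal.tsum_mul_left,
          measure_biUnion u.to_countable hudisj' fun _ _ => measurableSet_ball]
    _ ≤ K * μ (O \ W) := by
        gcongr
        exact Set.iUnion₂_subset fun i hi => Set.subset_sdiff.2
          ⟨(hsub i hi).trans (hut hi).2.2.1, (hut hi).2.2.2.1⟩
    _ ≤ K * ε := by gcongr

/-- Corollary: for a σ-finite doubling Borel regular measure `μ` and balls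
`B_i = B(x_i, r_i)` centred at points of `supp μ` with radii tending to zero, one has
`μ(limsup C·B_i \ limsup c·B_i) = 0` for any `0 < c < C`. -/
theorem limsup_scaled_balls_diff_null_of_doubling
    {X : Type*} [MetricSpace X] [MeasurableSpace X] [BorelSpace X]
    (μ : Measure X) [SigmaFinite μ] [μ.OuterRegular] (hμ : IsDoublingMeasure μ)
    (x : ℕ → X) (hx : ∀ i, x i ∈ measSupport μ)
    (r : ℕ → ℝ) (hr : Tendsto r atTop (nhds 0))
    (c C : ℝ) (hc : 0 < c) (hcC : c < C) :
    μ ((⋂ N : ℕ, ⋃ i : ℕ, ⋃ _ : N ≤ i, ball (x i) (C * r i)) \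
        ⋂ N : ℕ, ⋃ i : ℕ, ⋃ _ : N ≤ i, ball (x i) (c * r i)) = 0 := by
  obtain ⟨lam, r₀, -, hr₀, hdoub⟩ := hμ
  have hC : 0 < C := hc.trans hcC
  obtain ⟨k, hk⟩ := pow_unbounded_of_one_lt (5 * C / c) (one_lt_two (α := ℝ))
  have hK : ∀ᶠ i in atTop, 0 < r i →
      μ (ball (x i) (5 * (C * r i))) ≤ (lam ^ k : ℝ≥0) * μ (ball (x i) (c * r i)) := by
    have hlim : Tendsto (fun i => 2 ^ k * (c * r i)) atTop (nhds 0) := by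
      simpa using (hr.const_mul c).const_mul (2 ^ k)
    filter_upwards [hlim.eventually_lt_const hr₀] with i hi hri
    rw [ENNReal.coe_pow]
    refine (measure_mono (ball_subset_ball ?_)).trans
      (measure_ball_two_pow_mul_le (hdoub (x i) (hx i)) k (mul_pos hc hri) hi)
    rw [div_lt_iff₀ hc] at hk
    nlinarith
  have hmeas : ∀ a : ℝ, ∀ N : ℕ, MeasurableSet (⋃ i : ℕ, ⋃ _ : N ≤ i, ball (x i) (a * r i)) :=
    fun a N => .iUnion fun i => .iUnion fun _ => measurableSet_ball
  rw [Set.sdiff_iInter, measure_iUnion_null_iff]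
  intro N
  rw [← Set.inter_univ (_ \ _), ← iUnion_spanningSets μ, Set.inter_iUnion,
    measure_iUnion_null_iff]
  intro n
  refine measure_eq_zero_of_frequently_mem_ball hr hc hcC
    (((MeasurableSet.iInter (hmeas C)).diff (hmeas c N)).inter (measurableSet_spanningSets μ n))
    ((measure_mono Set.inter_subset_right).trans_lt (measure_spanningSets_lt_top μ n)).ne
    (fun p hp => frequently_atTop.2 fun M => ?_) ?_ hK
  · simpa using Set.mem_iInter.1 hp.1.1 M
  · filter_upwards [eventually_ge_atTop N] with i hi
    refine Set.disjoint_right.2 fun p hp hpi => hp.1.2 ?_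
    exact Set.mem_iUnion₂.2 ⟨i, hi, hpi⟩
end

section
/- Let S be a finite nonempty set of places of ℚ and m, n ∈ ℕ. Let Ψ = (ψ_{i,ν})_{1≤i≤n, ν∈S} be a collection of non-negative functions ψ_{i,ν} : ℤ^{m+n} → ℝ, and suppose that for all 1 ≤ i ≤ n and ν ∈ S one has ψ_{i,ν}(a,b)·‖a‖_ν^{-1} → 0 as ‖(a,b)‖_∞ → ∞ along pairs (a,b) ∈ ℤ^{m+n} with a ≠ 0, where ‖a‖_ν = max_{1≤j≤m}|a_j|_ν. Let W_{S,m,n}(Ψ) be the set of x = (x_{i,j,ν}) ∈ ℤ_S^{mn} such that for infinitely many (a,b) = (a_1,…,a_m,b_1,…,b_n) ∈ ℤ^{m+n} with a ≠ 0 one has |a_1 x_{i,1,ν} + ⋯ + a_m x_{i,m,ν} − b_i|_ν < ψ_{i,ν}(a,b) for all 1 ≤ i ≤ n and all ν ∈ S, and let Bad_{S,m,n}(Ψ) = W_{S,m,n}(Ψ) \ ⋂_{ℓ∈ℕ} W_{S,m,n}((1/ℓ)Ψ). Then μ_{S,m×n}(Bad_{S,m,n}(Ψ)) = 0. -/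
open MeasureTheory

noncomputable section

/-- Choice of the Borel σ-algebra on the `p`-adic integers. -/
instance padicIntMeasurableSpace (p : ℕ) [Fact p.Prime] : MeasurableSpace ℤ_[p] := borel _

instance padicIntBorelSpace (p : ℕ) [Fact p.Prime] : BorelSpace ℤ_[p] := ⟨rfl⟩

/-- The Haar probability measure on the compact additive group `ℤ_p`,
normalised so that `ℤ_p` itself has measure one. -/
def padicHaar (p : ℕ) [Fact p.Prime] : Measure ℤ_[p] :=
  Measure.addHaarMeasure (⊤ : TopologicalSpace.PositiveCompacts ℤ_[p])

instance padicHaarSigmaFinite (p : ℕ) [Fact p.Prime] : SigmaFinite (padicHaar p) := by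
  unfold padicHaar; infer_instance

/-- A place of `ℚ`: `none` is the infinite place, `some p` is the prime `p`. -/
abbrev Pl : Type := Option Nat.Primes

namespace Pl

/-- The "integer ring" attached to a place: `ℝ` for the infinite place (with the
measure supported on `[0,1)`) and `ℤ_p` for a finite place `p`. -/
def carrier : Pl → Type
  | none => ℝ
  | some p => @PadicInt p.1 ⟨p.2⟩

instance : (v : Pl) → CommRing (carrier v)
  | none => inferInstanceAs (CommRing ℝ)
  | some p => inferInstanceAs (CommRing (@PadicInt p.1 ⟨p.2⟩))

instance : (v : Pl) → MeasurableSpace (carrier v)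
  | none => inferInstanceAs (MeasurableSpace ℝ)
  | some p => letI : Fact p.1.Prime := ⟨p.2⟩; inferInstanceAs (MeasurableSpace ℤ_[p.1])

/-- The normalised Haar measure at a place: Lebesgue measure restricted to `[0,1)`
at the infinite place, and the normalised Haar measure of `ℤ_p` at a finite place. -/
def mu : (v : Pl) → Measure (carrier v)
  | none => volume.restrict (Set.Ico (0 : ℝ) 1)
  | some p => letI : Fact p.1.Prime := ⟨p.2⟩; padicHaar p.1

instance : ∀ v : Pl, SigmaFinite (mu v)
  | none => inferInstanceAs (SigmaFinite (volume.restrict (Set.Ico (0 : ℝ) 1)))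
  | some p => letI : Fact p.1.Prime := ⟨p.2⟩;
      inferInstanceAs (SigmaFinite (padicHaar p.1))

/-- The absolute value `|·|_ν` at a place. -/
def absv : (v : Pl) → carrier v → ℝ
  | none, x => |x|
  | some p, x => letI : Fact p.1.Prime := ⟨p.2⟩;
      ‖(show ℤ_[p.1] from x)‖

/-- Membership in `ℤ_ν`; at the infinite place `ℤ_∞ = [0,1)`. -/
def inZ : (v : Pl) → carrier v → Prop
  | none, x => x ∈ Set.Ico (0 : ℝ) 1
  | some _, _ => True

end Pl

/-- `ℤ_S^{mn}`, the space of `S`-arithmetic `n × m` matrices. -/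
def SpaceS (S : Finset Pl) (m n : ℕ) : Type :=
  (v : S) → Fin n → Fin m → Pl.carrier v

instance (S : Finset Pl) (m n : ℕ) : MeasurableSpace (SpaceS S m n) :=
  inferInstanceAs (MeasurableSpace ((v : S) → Fin n → Fin m → Pl.carrier v))

/-- The normalised product Haar measure `μ_{S,m×n}` on `ℤ_S^{mn}`. -/
def muS (S : Finset Pl) (m n : ℕ) : Measure (SpaceS S m n) :=
  Measure.pi fun v : S => Measure.pi fun _ : Fin n => Measure.pi fun _ : Fin m => Pl.mu v

/-- The value `a₁ x_{i,1,ν} + ⋯ + a_m x_{i,m,ν} - b_i` at the place `ν`. -/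
def linForm {m n : ℕ} (v : Pl) (x : Fin n → Fin m → Pl.carrier v)
    (a : Fin m → ℤ) (b : Fin n → ℤ) (i : Fin n) : Pl.carrier v :=
  (∑ j, (a j : Pl.carrier v) * x i j) - (b i : Pl.carrier v)

/-- `‖a‖_ν = max_j |a_j|_ν` for an integer vector `a`. -/
def aNorm {m : ℕ} (v : Pl) (a : Fin m → ℤ) : ℝ :=
  if h : (Finset.univ : Finset (Fin m)).Nonempty then
    Finset.univ.sup' h fun j => Pl.absv v ((a j : ℤ) : Pl.carrier v)
  else 0

/-- The sup-norm `‖(a,b)‖_∞` of an integer vector. -/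
def height {m n : ℕ} (a : Fin m → ℤ) (b : Fin n → ℤ) : ℕ :=
  (Finset.univ.sup fun j => (a j).natAbs) ⊔ (Finset.univ.sup fun i => (b i).natAbs)


/-- The set `W_{S,m,n}(Ψ)` of `Ψ`-approximable points of `ℤ_S^{mn}`: points `x` such
that `|a₁ x_{i,1,ν} + ⋯ + a_m x_{i,m,ν} − b_i|_ν < ψ_{i,ν}(a,b)` for all `i, ν` holds
for infinitely many `(a, b) ∈ ℤ^{m+n}` with `a ≠ 0`. -/
def WPsi (S : Finset Pl) (m n : ℕ)
    (ψ : Pl → Fin n → (Fin m → ℤ) → (Fin n → ℤ) → ℝ) : Set (SpaceS S m n) :=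
  {x | {ab : (Fin m → ℤ) × (Fin n → ℤ) | ab.1 ≠ 0 ∧
    ∀ (v : S) (i : Fin n),
      Pl.absv v (linForm v (x v) ab.1 ab.2 i) < ψ v i ab.1 ab.2}.Infinite}

/-- Cassels' lemma for infinite-set limsups over a countable index set. -/
theorem measure_infinite_thickening_diff_eq_zero {K α : Type*} [Countable K] [PseudoMetricSpace α]
    [SecondCountableTopology α] [MeasurableSpace α] [BorelSpace α] (μ : Measure α)
    [IsLocallyFiniteMeasure μ] [IsUnifLocDoublingMeasure μ] (s : K → Set α) (r : K → ℝ)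
    (hr : Filter.Tendsto r Filter.cofinite (nhds 0)) {M : ℝ} (hM : 0 < M) :
    μ ({x | {k | x ∈ Metric.thickening (r k) (s k)}.Infinite} \
      {x | {k | x ∈ Metric.thickening (M * r k) (s k)}.Infinite}) = 0 := by
  rcases finite_or_infinite K with hK | hK
  · have (x : α) : ¬ {k | x ∈ Metric.thickening (r k) (s k)}.Infinite :=
      Set.not_infinite.2 (Set.toFinite _)
    simp [this]
  obtain ⟨_⟩ := nonempty_denumerable K
  let e : ℕ ≃ K := (Denumerable.eqv K).symm
  have key (q : K → ℝ) : {x | {k | x ∈ Metric.thickening (q k) (s k)}.Infinite} =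
      Filter.blimsup (fun i => Metric.thickening (q (e i)) (s (e i))) Filter.atTop
        fun _ => True := by
    ext x
    rw [Filter.blimsup_true, Filter.mem_limsup_iff_frequently_mem, ← Nat.cofinite_eq_atTop,
      Filter.frequently_cofinite_iff_infinite, Set.mem_ofPred_eq,
      ← Set.infinite_image_iff e.injective.injOn, ← e.image_preimage {k | _}]
    rfl
  have h := blimsup_thickening_mul_ae_eq μ (fun _ => True) (fun i => s (e i)) hM (fun i => r (e i))
    (by rw [← Nat.cofinite_eq_atTop]; exact hr.comp e.injective.tendsto_cofinite)
  rw [key, key fun k => M * r k]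
  exact ae_le_set.1 h.symm.le

/-- A finite power of a uniformly locally doubling measure is uniformly locally doubling. -/
theorem isUnifLocDoublingMeasure_pi {ι α : Type*} [Fintype ι] [PseudoMetricSpace α]
    [MeasurableSpace α] (μ : Measure α) [SigmaFinite μ] [IsUnifLocDoublingMeasure μ] :
    IsUnifLocDoublingMeasure (Measure.pi fun _ : ι => μ) := by
  obtain ⟨C, hC⟩ := IsUnifLocDoublingMeasure.exists_measure_closedBall_le_mul'' (μ := μ)
  refine ⟨C ^ Fintype.card ι, ?_⟩
  filter_upwards [hC, self_mem_nhdsWithin] with ε hε hpos x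
  have hpos : 0 < ε := hpos
  rw [closedBall_pi _ (by positivity), closedBall_pi _ hpos.le, Measure.pi_pi, Measure.pi_pi]
  calc ∏ i, μ (Metric.closedBall (x i) (2 * ε))
      ≤ ∏ i, C * μ (Metric.closedBall (x i) ε) := Finset.prod_le_prod' fun i _ => hε (x i)
    _ = _ := by simp [Finset.prod_mul_distrib]

/-- A measurable set all of whose sections in one coordinate are null is null. -/
theorem measure_pi_eq_zero_of_forall_update {ι : Type*} [Fintype ι] [DecidableEq ι]
    {X : ι → Type*} [∀ i, MeasurableSpace (X i)] (μ : ∀ i, Measure (X i)) [∀ i, SigmaFinite (μ i)]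
    {N : Set (∀ i, X i)} (hN : MeasurableSet N) (i : ι)
    (h : ∀ x, μ i {y | Function.update x i y ∈ N} = 0) : Measure.pi μ N = 0 := by
  have hm : Measurable (N.indicator (1 : (∀ i, X i) → ENNReal)) := measurable_one.indicator hN
  rw [← lintegral_indicator_one hN]
  trans ∫⁻ _, 0 ∂Measure.pi μ
  · refine lintegral_eq_of_lmarginal_eq {i} hm measurable_const ?_
    rw [lmarginal_singleton, lmarginal_singleton]
    ext x
    have hs : MeasurableSet {y | Function.update x i y ∈ N} := measurable_update x hN
    rw [lintegral_zero, ← h x, ← lintegral_indicator_one hs]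
    rfl
  · simp

/-- The one-block case: shrinking neighbourhoods of rational affine hyperplanes in `R ^ m` by a
constant factor changes their limsup set by a null set only. -/
theorem measure_infinite_linear_diff_eq_zero {K R : Type*} [Countable K] [NormedCommRing R]
    [NormMulClass R] [SecondCountableTopology R] [MeasurableSpace R] [BorelSpace R]
    (μ : Measure R) [SigmaFinite μ] [IsLocallyFiniteMeasure μ] [IsUnifLocDoublingMeasure μ]
    (hdiv : ∀ c t : R, c ≠ 0 → ‖t‖ ≤ ‖c‖ → ∃ s, c * s = t)
    {m : ℕ} (hm : 0 < m) (P : K → Prop) (a : K → Fin m → R) (b : K → R) (ψ A : K → ℝ)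
    (hA : ∀ k, P k → 0 < A k) (haA : ∀ k j, ‖a k j‖ ≤ A k) (hAa : ∀ k, ∃ j, ‖a k j‖ = A k)
    (hψ : ∀ k, 0 ≤ ψ k)
    (hlim : ∀ ε : ℝ, 0 < ε → ∀ᶠ k in Filter.cofinite, P k → ψ k * (A k)⁻¹ < ε)
    {c : ℝ} (hc : 0 < c) :
    Measure.pi (fun _ : Fin m => μ)
      ({x | {k | P k ∧ ‖∑ j, a k j * x j - b k‖ < ψ k}.Infinite} \
        {x | {k | P k ∧ ‖∑ j, a k j * x j - b k‖ < ψ k / c}.Infinite}) = 0 := by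
  classical
  have := isUnifLocDoublingMeasure_pi (ι := Fin m) μ
  have hm' : (0 : ℝ) < m := Nat.cast_pos.2 hm
  let r : K → ℝ := fun k => if P k then ψ k * (A k)⁻¹ else 0
  let s : K → Set (Fin m → R) := fun k => {x | P k ∧ ∑ j, a k j * x j = b k}
  have hr : Filter.Tendsto r Filter.cofinite (nhds 0) := by
    rw [Metric.tendsto_nhds]
    intro ε hε
    filter_upwards [hlim ε hε] with k hk
    by_cases hP : P k
    · have := hA k hP
      have := hψ k
      rw [Real.dist_0_eq_abs, abs_of_nonneg (by simp only [r, hP, if_true]; positivity)]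
      simpa [r, hP] using hk hP
    · simpa [r, hP] using hε
  refine measure_mono_null ?_ (measure_infinite_thickening_diff_eq_zero _ s r hr
    (M := (m * c)⁻¹) (by positivity))
  refine Set.sdiff_subset_sdiff (fun x hx => ?_) fun x hx => ?_
  · refine (hx.sdiff (hlim 1 one_pos)).mono ?_
    rintro k ⟨⟨hP, hk⟩, hk1⟩
    have hk1 : ψ k * (A k)⁻¹ < 1 := not_not.1 hk1 hP
    have hApos := hA k hP
    obtain ⟨j, hj⟩ := hAa k
    have hψA : ψ k < A k := by rwa [← div_eq_mul_inv, div_lt_one hApos] at hk1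
    obtain ⟨t, ht⟩ := hdiv (a k j) (∑ j, a k j * x j - b k)
      (norm_pos_iff.1 (hj ▸ hApos)) (by rw [hj]; exact (hk.trans hψA).le)
    refine Metric.mem_thickening_iff.2 ⟨x - Pi.single j t, ⟨hP, ?_⟩, ?_⟩
    · simp only [Pi.sub_apply, mul_sub, Finset.sum_sub_distrib]
      rw [Finset.sum_eq_single (f := fun i => a k i * (Pi.single j t : Fin m → R) i) j]
      · simp [ht]
      · intro i _ hi
        simp [hi]
      · simp
    · rw [dist_eq_norm, sub_sub_cancel, Pi.norm_single]
      simp only [r, hP, if_true]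
      rw [← div_eq_mul_inv, lt_div_iff₀ hApos, ← hj, ← norm_mul, mul_comm, ht]
      exact hk
  · refine Set.Infinite.mono ?_ hx
    intro k hk
    obtain ⟨y, ⟨hP, hy⟩, hxy⟩ := Metric.mem_thickening_iff.1 hk
    have hApos := hA k hP
    simp only [r, hP, if_true] at hxy
    refine ⟨hP, ?_⟩
    calc ‖∑ j, a k j * x j - b k‖ = ‖∑ j, a k j * (x j - y j)‖ := by
          simp [← hy, mul_sub, Finset.sum_sub_distrib]
      _ ≤ ∑ _j : Fin m, A k * dist x y := by
          refine norm_sum_le_of_le _ fun j _ => ?_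
          rw [norm_mul, ← dist_eq_norm]
          exact mul_le_mul (haA k j) (dist_le_pi_dist x y j) dist_nonneg hApos.le
      _ = m * (A k * dist x y) := by simp
      _ < m * (A k * ((m * c)⁻¹ * (ψ k * (A k)⁻¹))) := by gcongr
      _ = ψ k / c := by field_simp

/-- Balls of `ℤ_p` are covered by `p ^ 2` translates of a ball of half the radius. -/
instance isUnifLocDoublingMeasure_padicHaar (p : ℕ) [Fact p.Prime] :
    IsUnifLocDoublingMeasure (padicHaar p) := by
  have hp2 : (2 : ℝ) ≤ p := by exact_mod_cast (Fact.out : p.Prime).two_le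
  have hp0 : (0 : ℝ) < p := by linarith
  have : (padicHaar p).IsAddHaarMeasure := by unfold padicHaar; infer_instance
  refine ⟨(p : NNReal) ^ 2, ?_⟩
  have hsmall : ∀ᶠ ε : ℝ in nhdsWithin 0 (Set.Ioi 0), ε < (p : ℝ)⁻¹ :=
    nhdsWithin_le_nhds (gt_mem_nhds (by positivity))
  filter_upwards [hsmall, self_mem_nhdsWithin] with ε hε hpos x
  have hpos : 0 < ε := hpos
  obtain ⟨k, hk, hk'⟩ := exists_nat_pow_near_of_lt_one hpos (y := (p : ℝ)⁻¹)
    (hε.le.trans (inv_le_one_of_one_le₀ (by linarith))) (by positivity)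
    (inv_lt_one_of_one_lt₀ (by linarith))
  obtain ⟨d, rfl⟩ : ∃ d, k = d + 1 := by
    refine Nat.exists_eq_succ_of_ne_zero ?_
    rintro rfl
    simp only [zero_add, pow_one] at hk
    exact hk.not_gt hε
  have h2ε : 2 * ε ≤ (p : ℝ) ^ (-d : ℤ) := calc
    2 * ε ≤ p * (p : ℝ)⁻¹ ^ (d + 1) := by gcongr
    _ = (p : ℝ) ^ (-d : ℤ) := by
      rw [pow_succ', mul_inv_cancel_left₀ hp0.ne', inv_pow, zpow_neg, zpow_natCast]
  have hcover : Metric.closedBall x (2 * ε) ⊆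
      ⋃ c ∈ Finset.range (p ^ 2), Metric.closedBall (x + (p : ℤ_[p]) ^ d * c) ε := by
    intro y hy
    rw [Metric.mem_closedBall, dist_eq_norm] at hy
    obtain ⟨z, hz⟩ := Ideal.mem_span_singleton.1
      ((PadicInt.norm_le_pow_iff_mem_span_pow _ _).1 (hy.trans h2ε))
    obtain ⟨w, hw⟩ := Ideal.mem_span_singleton.1 (PadicInt.appr_spec 2 z)
    refine Set.mem_biUnion (Finset.mem_coe.2 (Finset.mem_range.2 (PadicInt.appr_lt z 2))) ?_
    have hyw : y - (x + (p : ℤ_[p]) ^ d * z.appr 2) = (p : ℤ_[p]) ^ (d + 1 + 1) * w := by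
      linear_combination hz + (p : ℤ_[p]) ^ d * hw
    rw [Metric.mem_closedBall, dist_eq_norm, hyw]
    refine le_trans ?_ hk.le
    rw [norm_mul, norm_pow, PadicInt.norm_p]
    exact mul_le_of_le_one_right (by positivity) (PadicInt.norm_le_one w)
  have htrans (t : ℤ_[p]) :
      padicHaar p (Metric.closedBall (x + t) ε) = padicHaar p (Metric.closedBall x ε) := by
    rw [← measure_preimage_add (padicHaar p) t (Metric.closedBall (x + t) ε)]
    congr 1
    ext y
    simp [add_comm x t]
  calc padicHaar p (Metric.closedBall x (2 * ε))
      ≤ ∑ c ∈ Finset.range (p ^ 2),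
          padicHaar p (Metric.closedBall (x + (p : ℤ_[p]) ^ d * c) ε) :=
        (measure_mono hcover).trans (measure_biUnion_finset_le _ _)
    _ = _ := by simp [htrans]

namespace Pl

theorem absv_intCast_pos (v : Pl) {a : ℤ} (ha : a ≠ 0) : 0 < absv v (a : carrier v) := by
  rcases v with _ | p
  · exact abs_pos.2 (Int.cast_ne_zero (α := ℝ).2 ha)
  · have : Fact p.1.Prime := ⟨p.2⟩
    exact norm_pos_iff.2 (Int.cast_ne_zero (α := ℤ_[p.1]).2 ha)

theorem measurable_absv_linear (v : Pl) {m : ℕ} (a : Fin m → ℤ) (b : ℤ) :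
    Measurable fun z : Fin m → carrier v =>
      absv v (∑ j, (a j : carrier v) * z j - (b : carrier v)) := by
  rcases v with _ | p
  · have : Measurable fun z : Fin m → ℝ => |∑ j, (a j : ℝ) * z j - (b : ℝ)| :=
      Continuous.measurable (by fun_prop)
    exact this
  · have : Fact p.1.Prime := ⟨p.2⟩
    have : SecondCountableTopology ℤ_[p.1] := EMetric.secondCountable_of_sigmaCompact _
    have : Measurable fun z : Fin m → ℤ_[p.1] => ‖∑ j, (a j : ℤ_[p.1]) * z j - (b : ℤ_[p.1])‖ :=
      Continuous.measurable (by fun_prop)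
    exact this

end Pl

theorem absv_le_aNorm {m : ℕ} (v : Pl) (a : Fin m → ℤ) (j : Fin m) :
    Pl.absv v (a j : Pl.carrier v) ≤ aNorm v a := by
  have h : (Finset.univ : Finset (Fin m)).Nonempty := ⟨j, Finset.mem_univ j⟩
  rw [aNorm, dif_pos h]
  exact Finset.le_sup' (fun j => Pl.absv v (a j : Pl.carrier v)) (Finset.mem_univ j)

theorem exists_absv_eq_aNorm {m : ℕ} (hm : 0 < m) (v : Pl) (a : Fin m → ℤ) :
    ∃ j, Pl.absv v (a j : Pl.carrier v) = aNorm v a := by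
  have h : (Finset.univ : Finset (Fin m)).Nonempty := ⟨⟨0, hm⟩, Finset.mem_univ _⟩
  rw [aNorm, dif_pos h]
  obtain ⟨j, -, hj⟩ := Finset.exists_mem_eq_sup' h fun j => Pl.absv v (a j : Pl.carrier v)
  exact ⟨j, hj.symm⟩

theorem aNorm_pos {m : ℕ} (v : Pl) {a : Fin m → ℤ} (ha : a ≠ 0) : 0 < aNorm v a := by
  obtain ⟨j, hj⟩ := Function.ne_iff.1 ha
  exact (Pl.absv_intCast_pos v hj).trans_le (absv_le_aNorm v a j)

/-- The one-block case at an arbitrary place. -/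
theorem measure_infinite_absv_linear_diff_eq_zero {K : Type*} [Countable K] (v : Pl) {m : ℕ}
    (hm : 0 < m) (P : K → Prop) (a : K → Fin m → ℤ) (b : K → ℤ) (ψ : K → ℝ)
    (ha : ∀ k, P k → a k ≠ 0) (hψ : ∀ k, 0 ≤ ψ k)
    (hlim : ∀ ε : ℝ, 0 < ε → ∀ᶠ k in Filter.cofinite, P k → ψ k * (aNorm v (a k))⁻¹ < ε)
    {c : ℝ} (hc : 0 < c) :
    Measure.pi (fun _ : Fin m => Pl.mu v)
      ({x | {k | P k ∧ Pl.absv v (∑ j, (a k j : Pl.carrier v) * x j - (b k : Pl.carrier v))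
          < ψ k}.Infinite} \
        {x | {k | P k ∧ Pl.absv v (∑ j, (a k j : Pl.carrier v) * x j - (b k : Pl.carrier v))
          < ψ k / c}.Infinite}) = 0 := by
  have hA := fun k hk => aNorm_pos v (ha k hk)
  have haA := fun k j => absv_le_aNorm v (a k) j
  have hAa := fun k => exists_absv_eq_aNorm hm v (a k)
  rcases v with _ | p
  · have h := measure_infinite_linear_diff_eq_zero (volume : Measure ℝ)
      (fun c t hc _ => ⟨t / c, mul_div_cancel₀ t hc⟩) hm P (fun k j => (a k j : ℝ))
      (fun k => (b k : ℝ)) ψ _ hA haA hAa hψ hlim hc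
    have hle : Measure.pi (fun _ : Fin m => volume.restrict (Set.Ico (0 : ℝ) 1)) ≤
        Measure.pi fun _ : Fin m => (volume : Measure ℝ) := by
      rw [← Measure.restrict_pi_pi]
      exact Measure.restrict_le_self
    exact nonpos_iff_eq_zero.1 ((hle _).trans h.le)
  · have : Fact p.1.Prime := ⟨p.2⟩
    have : SecondCountableTopology ℤ_[p.1] := EMetric.secondCountable_of_sigmaCompact _
    have : IsLocallyFiniteMeasure (padicHaar p.1) := by unfold padicHaar; infer_instance
    refine measure_infinite_linear_diff_eq_zero (padicHaar p.1) (fun c t hc hct => ?_) hm P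
      (fun k j => (a k j : ℤ_[p.1])) (fun k => (b k : ℤ_[p.1])) ψ _ hA haA hAa hψ hlim hc
    have hc' : (c : ℚ_[p.1]) ≠ 0 := by simpa using hc
    refine ⟨⟨(t : ℚ_[p.1]) / c, ?_⟩, ?_⟩
    · rw [norm_div, ← PadicInt.norm_def, ← PadicInt.norm_def]
      exact div_le_one_of_le₀ hct (norm_nonneg _)
    · apply Subtype.ext
      exact mul_div_cancel₀ (t : ℚ_[p.1]) hc'

theorem measurableSet_WPsi (S : Finset Pl) (m n : ℕ)
    (ψ : Pl → Fin n → (Fin m → ℤ) → (Fin n → ℤ) → ℝ) : MeasurableSet (WPsi S m n ψ) := by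
  have hW : WPsi S m n ψ = ⋂ F : Finset ((Fin m → ℤ) × (Fin n → ℤ)),
      ⋃ ab ∈ {ab | ab ∉ F ∧ ab.1 ≠ 0}, ⋂ (v : S) (i : Fin n), {x : SpaceS S m n |
        Pl.absv v (linForm v (x v) ab.1 ab.2 i) < ψ v i ab.1 ab.2} := by
    ext x
    simp only [WPsi, Set.mem_ofPred_eq, Set.mem_iInter, Set.mem_iUnion, exists_prop]
    refine ⟨fun h F => ?_, fun h hfin => ?_⟩
    · obtain ⟨ab, hab, hF⟩ := h.exists_notMem_finset F
      exact ⟨ab, ⟨hF, hab.1⟩, hab.2⟩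
    · obtain ⟨ab, ⟨hF, h0⟩, hab⟩ := h hfin.toFinset
      exact hF (hfin.mem_toFinset.2 ⟨h0, hab⟩)
  rw [hW]
  refine .iInter fun F => .biUnion (Set.to_countable _) fun ab _ =>
    .iInter fun v => .iInter fun i => ?_
  have hproj : Measurable fun x : SpaceS S m n => x v i :=
    (measurable_pi_apply i).comp (measurable_pi_apply v)
  exact measurableSet_lt ((Pl.measurable_absv_linear v ab.1 (ab.2 i)).comp hproj) measurable_const

theorem finite_setOf_height_lt (m n N : ℕ) :
    {ab : (Fin m → ℤ) × (Fin n → ℤ) | height ab.1 ab.2 < N}.Finite := by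
  refine ((Set.finite_Icc (fun _ : Fin m => (-N : ℤ)) fun _ => (N : ℤ)).prod
    (Set.finite_Icc (fun _ : Fin n => (-N : ℤ)) fun _ => (N : ℤ))).subset ?_
  rintro ⟨a, b⟩ hab
  have ha (j : Fin m) : (a j).natAbs < N :=
    ((Finset.le_sup (f := fun j => (a j).natAbs) (Finset.mem_univ j)).trans le_sup_left).trans_lt
      hab
  have hb (i : Fin n) : (b i).natAbs < N :=
    ((Finset.le_sup (f := fun i => (b i).natAbs) (Finset.mem_univ i)).trans le_sup_right).trans_lt
      hab
  refine ⟨⟨fun j => ?_, fun j => ?_⟩, fun i => ?_, fun i => ?_⟩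
  · have := ha j; dsimp only; omega
  · have := ha j; dsimp only; omega
  · have := hb i; dsimp only; omega
  · have := hb i; dsimp only; omega

/-- Dividing a single function `ψ_{i,ν}` by a constant changes `W(Ψ)` by a null set only. -/
theorem muS_WPsi_diff_eq_zero (S : Finset Pl) (m n : ℕ) (hm : 0 < m)
    (ψ φ : Pl → Fin n → (Fin m → ℤ) → (Fin n → ℤ) → ℝ) (v : S) (i : Fin n)
    (hψ0 : ∀ a b, 0 ≤ ψ v i a b)
    (hψlim : ∀ ε : ℝ, 0 < ε → ∃ N : ℕ,
      ∀ (a : Fin m → ℤ) (b : Fin n → ℤ), a ≠ 0 → N ≤ height a b →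
        ψ v i a b * (aNorm v a)⁻¹ < ε)
    {c : ℝ} (hc : 0 < c) (hφ : ∀ a b, φ v i a b = ψ v i a b / c)
    (hφψ : ∀ (w : S) (j : Fin n), (w, j) ≠ (v, i) → φ w j = ψ w j) :
    muS S m n (WPsi S m n ψ \ WPsi S m n φ) = 0 := by
  classical
  have hmeas : MeasurableSet (WPsi S m n ψ \ WPsi S m n φ) :=
    (measurableSet_WPsi S m n ψ).diff (measurableSet_WPsi S m n φ)
  refine measure_pi_eq_zero_of_forall_update _ hmeas v fun x => ?_
  refine measure_pi_eq_zero_of_forall_update _ (measurable_update x hmeas) i fun y => ?_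
  let P : (Fin m → ℤ) × (Fin n → ℤ) → Prop := fun ab => ab.1 ≠ 0 ∧
    ∀ (w : S) (j : Fin n), (w, j) ≠ (v, i) →
      Pl.absv w (linForm w (Function.update x v y w) ab.1 ab.2 j) < ψ w j ab.1 ab.2
  have hsection (χ : Pl → Fin n → (Fin m → ℤ) → (Fin n → ℤ) → ℝ)
      (hχ : ∀ (w : S) (j : Fin n), (w, j) ≠ (v, i) → χ w j = ψ w j)
      (z : Fin m → Pl.carrier v) :
      (Function.update x v (Function.update y i z) : SpaceS S m n) ∈ WPsi S m n χ ↔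
        {ab : (Fin m → ℤ) × (Fin n → ℤ) | P ab ∧ Pl.absv v
          (∑ j, (ab.1 j : Pl.carrier v) * z j - (ab.2 i : Pl.carrier v))
            < χ v i ab.1 ab.2}.Infinite := by
    have hother (w : S) (j : Fin n) (hwj : (w, j) ≠ (v, i)) (a : Fin m → ℤ) (b : Fin n → ℤ) :
        linForm w (Function.update x v (Function.update y i z) w) a b j =
          linForm w (Function.update x v y w) a b j := by
      by_cases hw : w = v
      · subst hw
        have hj : j ≠ i := fun h => hwj (by rw [h])
        simp [linForm, hj]
      · simp [hw]
    have hself (a : Fin m → ℤ) (b : Fin n → ℤ) :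
        linForm v (Function.update x v (Function.update y i z) v) a b i =
          ∑ j, (a j : Pl.carrier v) * z j - (b i : Pl.carrier v) := by
      simp [linForm]
    change Set.Infinite _ ↔ Set.Infinite _
    suffices h : ∀ s t : Set ((Fin m → ℤ) × (Fin n → ℤ)), s = t → (s.Infinite ↔ t.Infinite) by
      refine h _ _ (Set.ext fun ab => ⟨fun ⟨h0, h1⟩ => ⟨⟨h0, fun w j hwj => ?_⟩, ?_⟩,
        fun ⟨⟨h0, h1⟩, h2⟩ => ⟨h0, fun w j => ?_⟩⟩)
      · rw [← hother w j hwj, ← hχ w j hwj]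
        exact h1 w j
      · rw [← hself]
        exact h1 v i
      · by_cases hwj : (w, j) = (v, i)
        · cases hwj
          rw [hself]
          exact h2
        · rw [hother w j hwj, hχ w j hwj]
          exact h1 w j hwj
    rintro s _ rfl
    rfl
  refine measure_mono_null ?_ (measure_infinite_absv_linear_diff_eq_zero v hm P (fun ab => ab.1)
    (fun ab => ab.2 i) (fun ab => ψ v i ab.1 ab.2) (fun _ h => h.1) (fun ab => hψ0 _ _)
    (fun ε hε => ?_) hc)
  · rintro z ⟨h1, h2⟩
    refine ⟨(hsection ψ (fun _ _ _ => rfl) z).1 h1, fun h => h2 ((hsection φ hφψ z).2 ?_)⟩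
    simpa only [hφ, Set.mem_ofPred_eq] using h
  · obtain ⟨N, hN⟩ := hψlim ε hε
    refine Filter.mem_of_superset (finite_setOf_height_lt m n N).compl_mem_cofinite ?_
    intro ab hab hP
    exact hN _ _ hP.1 (not_lt.1 hab)

/-- Theorem: if the non-negative functions `ψ_{i,ν}` satisfy
`ψ_{i,ν}(a,b)·‖a‖_ν⁻¹ → 0` as `‖(a,b)‖_∞ → ∞` (along `a ≠ 0`), then the set
`Bad_{S,m,n}(Ψ) = W_{S,m,n}(Ψ) \ ⋂_ℓ W_{S,m,n}((1/ℓ)Ψ)` is `μ_{S,m×n}`-null. -/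
theorem badPsi_measure_zero (S : Finset Pl) (hS : S.Nonempty) (m n : ℕ)
    (hm : 0 < m) (hn : 0 < n)
    (ψ : Pl → Fin n → (Fin m → ℤ) → (Fin n → ℤ) → ℝ)
    (hψ0 : ∀ v ∈ S, ∀ (i : Fin n) (a : Fin m → ℤ) (b : Fin n → ℤ), 0 ≤ ψ v i a b)
    (hψlim : ∀ v ∈ S, ∀ i : Fin n, ∀ ε : ℝ, 0 < ε → ∃ N : ℕ,
      ∀ (a : Fin m → ℤ) (b : Fin n → ℤ), a ≠ 0 → N ≤ height a b →
        ψ v i a b * (aNorm v a)⁻¹ < ε) :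
    muS S m n (WPsi S m n ψ \
      ⋂ l : ℕ, WPsi S m n fun v i a b => ψ v i a b / (l + 1)) = 0 := by
  classical
  rw [Set.sdiff_iInter, measure_iUnion_null_iff]
  intro l
  have hl : (0 : ℝ) < l + 1 := by positivity
  let φ : Finset (Pl × Fin n) → Pl → Fin n → (Fin m → ℤ) → (Fin n → ℤ) → ℝ :=
    fun T v i a b => if (v, i) ∈ T then ψ v i a b / (l + 1) else ψ v i a b
  have key (T : Finset (Pl × Fin n)) (hT : ∀ t ∈ T, t.1 ∈ S) :
      muS S m n (WPsi S m n ψ \ WPsi S m n (φ T)) = 0 := by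
    induction T using Finset.induction_on with
    | empty => simp [φ]
    | insert t T ht ih =>
      obtain ⟨v, i⟩ := t
      have hv : v ∈ S := hT _ (Finset.mem_insert_self _ _)
      have hφt : φ T v i = ψ v i := by ext a b; simp [φ, ht]
      have hstep := muS_WPsi_diff_eq_zero S m n hm (φ T) (φ (insert (v, i) T)) ⟨v, hv⟩ i
        (by simpa only [hφt] using hψ0 v hv i) (by simpa only [hφt] using hψlim v hv i) hl
        (fun a b => by simp [φ, ht]) fun w j hwj => by
          have : ((w : Pl), j) ≠ (v, i) := fun h => hwj (by
            simp only [Prod.mk.injEq] at h ⊢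
            exact ⟨Subtype.ext h.1, h.2⟩)
          ext a b
          simp only [φ, Finset.mem_insert, this, false_or]
      refine measure_mono_null (fun x hx => ?_) (measure_union_null
        (ih fun t ht => hT t (Finset.mem_insert_of_mem ht)) hstep)
      by_cases hxT : x ∈ WPsi S m n (φ T)
      · exact Or.inr ⟨hxT, hx.2⟩
      · exact Or.inl ⟨hx.1, hxT⟩
  have hfull : WPsi S m n (φ (S ×ˢ Finset.univ)) =
      WPsi S m n fun v i a b => ψ v i a b / (l + 1) := by
    simp [WPsi, φ]
  rw [← hfull]
  exact key _ fun t ht => (Finset.mem_product.1 ht).1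

end
end

section
/- Let n, m ∈ ℕ, let S be a finite nonempty set of places of ℚ and set ω = m+n if ∞ ∉ S and ω = m if ∞ ∈ S. Let H_1,…,H_ω ≥ 1 be reals and ψ_{i,ν} ∈ (0,1) for 1 ≤ i ≤ n, ν ∈ S. For a finite place ν ∈ S* let ψ̃_{i,ν} be the largest number of the form ν^{-δ} with δ ∈ ℤ not exceeding ψ_{i,ν}, and if ∞ ∈ S set ψ̃_{i,∞} = ψ_{i,∞}. Suppose (∏_{ν∈S} ∏_{1≤i≤n} ψ̃_{i,ν}) · ∏_{ℓ=1}^ω H_ℓ ≥ 1. Then for any x = (x_{i,j,ν}) ∈ ℤ_S^{mn} there exists a nonzero (a,b) = (a_1,…,a_m,b_1,…,b_n) ∈ ℤ^{m+n} satisfying: |a_1 x_{i,1,ν} + ⋯ + a_m x_{i,m,ν} − b_i|_ν ≤ ψ_{i,ν} for all 1 ≤ i ≤ n and all finite ν ∈ S*; |a_1 x_{i,1,∞} + ⋯ + a_m x_{i,m,∞} − b_i| < ψ_{i,∞} for all 1 ≤ i ≤ n if ∞ ∈ S; |a_j| ≤ H_j for 1 ≤ j ≤ m; and |b_i| ≤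 H_{m+i} for 1 ≤ i ≤ n if ∞ ∉ S. -/
open MeasureTheory

noncomputable section

/-- `ψ̃`: at a finite place `p`, the largest number of the form `p^{-δ}` (`δ ∈ ℤ`) not
exceeding `t`; at the infinite place, `t` itself. -/
def psiTilde : (v : Pl) → ℝ → ℝ
  | none, t => t
  | some p, t => (p.1 : ℝ) ^ (Int.log p.1 t)

/-- Minkowski's theorem on linear forms, with strict inequalities. -/
theorem exists_int_ne_zero_abs_mulVec_lt {ι : Type*} [Fintype ι] [DecidableEq ι]
    (M : Matrix ι ι ℝ) (hM : M.det ≠ 0) (B : ι → ℝ) (hB : ∀ i, 0 < B i)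
    (h : |M.det| < ∏ i, B i) :
    ∃ z : ι → ℤ, z ≠ 0 ∧ ∀ i, |M.mulVec (fun k => (z k : ℝ)) i| < B i := by
  let f : (ι → ℝ) →ₗ[ℝ] (ι → ℝ) := Matrix.toLin' M
  have hf : LinearMap.det f = M.det := LinearMap.det_toLin' M
  let box : Set (ι → ℝ) := Set.univ.pi fun i => Set.Ioo (-B i) (B i)
  have hvol : volume (f ⁻¹' box) =
      ENNReal.ofReal (|M.det|⁻¹ * (2 ^ Fintype.card ι * ∏ i, B i)) := by
    rw [Measure.addHaar_preimage_linearMap _ (by rwa [hf]), hf, Real.volume_pi_Ioo, abs_inv,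
      ← ENNReal.ofReal_prod_of_nonneg (fun i _ => by linarith [hB i]),
      ← ENNReal.ofReal_mul (by positivity)]
    congr 2
    rw [← Finset.card_univ, ← Finset.prod_const, ← Finset.prod_mul_distrib]
    exact Finset.prod_congr rfl fun i _ => by ring
  have hlt : volume (ZSpan.fundamentalDomain (Pi.basisFun ℝ ι)) *
      2 ^ Module.finrank ℝ (ι → ℝ) < volume (f ⁻¹' box) := by
    rw [hvol, ZSpan.fundamentalDomain_pi_basisFun, Real.volume_pi_Ico]
    have hdet : 0 < |M.det| := abs_pos.2 hM
    have h2 : (2 : ENNReal) ^ Module.finrank ℝ (ι → ℝ) =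
        ENNReal.ofReal (2 ^ Fintype.card ι) := by
      rw [Module.finrank_fintype_fun_eq_card, ENNReal.ofReal_pow zero_le_two]
      simp
    rw [h2]
    simp only [sub_zero, ENNReal.ofReal_one, Finset.prod_const_one, one_mul]
    have hpos : 0 < ∏ i, B i := Finset.prod_pos fun i _ => hB i
    rw [ENNReal.ofReal_lt_ofReal_iff (by positivity), inv_mul_eq_div, lt_div_iff₀ hdet]
    gcongr
  have hconv : Convex ℝ (f ⁻¹' box) :=
    (convex_pi fun i _ => convex_Ioo (-B i) (B i)).linear_preimage f
  have hsymm : ∀ v ∈ f ⁻¹' box, -v ∈ f ⁻¹' box := by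
    intro v hv
    have hneg : f (-v) ∈ box := fun i _ => by
      have hvi := hv i trivial
      rw [map_neg]
      exact ⟨neg_lt_neg hvi.2, by simpa using neg_lt_neg hvi.1⟩
    exact hneg
  have : Countable (Submodule.span ℤ (Set.range (Pi.basisFun ℝ ι))).toAddSubgroup :=
    inferInstanceAs (Countable (Submodule.span ℤ (Set.range (Pi.basisFun ℝ ι))))
  obtain ⟨w, hw0, hw⟩ := exists_ne_zero_mem_lattice_of_measure_mul_two_pow_lt_measure
    (ZSpan.isAddFundamentalDomain' (Pi.basisFun ℝ ι) volume) hsymm hconv hlt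
  have hmem : ∀ i, ∃ k : ℤ, (k : ℝ) = (w : ι → ℝ) i := fun i => by
    simpa using ((Pi.basisFun ℝ ι).mem_span_iff_repr_mem ℤ (w : ι → ℝ)).1 w.2 i
  choose z hz using hmem
  have hzw : (fun k => (z k : ℝ)) = (w : ι → ℝ) := funext hz
  refine ⟨z, fun h0 => hw0 (Subtype.ext (hzw.symm.trans ?_)), fun i => ?_⟩
  · rw [h0]; ext i; simp
  · rw [hzw]
    exact abs_lt.2 (hw i trivial)

/-- Minkowski's theorem on linear forms for a block triangular system. -/
theorem exists_int_ne_zero_abs_lt_of_prod_lt {ι κ : Type*} [Fintype ι] [Fintype κ]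
    (Y : κ → ι → ℝ) (Q B : κ → ℝ) (A : ι → ℝ) (hQ : ∀ i, 0 < Q i) (hB : ∀ i, 0 < B i)
    (hA : ∀ j, 0 < A j) (h : ∏ i, Q i < (∏ j, A j) * ∏ i, B i) :
    ∃ (a : ι → ℤ) (c : κ → ℤ), ¬(a = 0 ∧ c = 0) ∧ (∀ j, |(a j : ℝ)| < A j) ∧
      ∀ i, |(∑ j, (a j : ℝ) * Y i j) + Q i * c i| < B i := by
  classical
  have hQpos : 0 < ∏ i, Q i := Finset.prod_pos fun i _ => hQ i
  have hdet : (Matrix.fromBlocks 1 0 (Matrix.of Y) (Matrix.diagonal Q)).det = ∏ i, Q i := by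
    rw [Matrix.det_fromBlocks_zero₁₂, Matrix.det_one, one_mul, Matrix.det_diagonal]
  obtain ⟨z, hz0, hz⟩ := exists_int_ne_zero_abs_mulVec_lt
    (Matrix.fromBlocks 1 0 (Matrix.of Y) (Matrix.diagonal Q)) (by rw [hdet]; exact hQpos.ne')
    (Sum.elim A B) (by rintro (j | i) <;> simp [hA, hB])
    (by rw [hdet, abs_of_pos hQpos]; simpa using h)
  refine ⟨fun j => z (.inl j), fun i => z (.inr i), ?_, fun j => ?_, fun i => ?_⟩
  · rintro ⟨ha, hc⟩
    refine hz0 (funext ?_)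
    rintro (j | i)
    · exact congrFun ha j
    · exact congrFun hc i
  · simpa [Matrix.mulVec, dotProduct, Matrix.one_apply] using hz (.inl j)
  · simpa [Matrix.mulVec, dotProduct, Matrix.diagonal_apply, mul_comm] using hz (.inr i)

/-- Simultaneous approximation of finitely many `p`-adic integers by one integer. -/
theorem exists_int_forall_pow_dvd_sub (T : Finset Nat.Primes) (d : Nat.Primes → ℕ)
    (y : (p : Nat.Primes) → @PadicInt p.1 ⟨p.2⟩) :
    ∃ X : ℤ, ∀ p ∈ T, letI : Fact p.1.Prime := ⟨p.2⟩;
      ((p.1 : ℤ_[p.1]) ^ d p) ∣ (y p - (X : ℤ_[p.1])) := by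
  obtain ⟨k, hk⟩ := Nat.chineseRemainderOfFinset
    (fun p : Nat.Primes => @PadicInt.appr p.1 ⟨p.2⟩ (y p) (d p))
    (fun p : Nat.Primes => p.1 ^ d p) T (fun p _ => pow_ne_zero _ p.2.ne_zero)
    (fun p _ q _ hpq => Nat.Coprime.pow _ _
      ((Nat.coprime_primes p.2 q.2).2 fun h => hpq (Subtype.ext h)))
  refine ⟨k, fun p hp => ?_⟩
  let : Fact p.1.Prime := ⟨p.2⟩
  have happr := Ideal.mem_span_singleton.1 (PadicInt.appr_spec (d p) (y p))
  have hmod := map_dvd (Int.castRingHom ℤ_[p.1]) (Nat.modEq_iff_dvd.1 (hk p hp))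
  rw [eq_intCast, eq_intCast] at hmod
  push_cast at hmod ⊢
  simpa only [sub_add_sub_cancel] using dvd_add happr hmod

/-- Lemma (S-arithmetic Dirichlet): given `H₁, …, H_ω ≥ 1` (`ω = m + n` if `∞ ∉ S`,
`ω = m` if `∞ ∈ S`; here the first `m` bounds are `Ha` and the last `n` are `Hb`) and
`ψ_{i,ν} ∈ (0,1)` with `∏ ψ̃_{i,ν} · ∏ H_ℓ ≥ 1`, every `x ∈ ℤ_S^{mn}` admits a nonzero
integer vector `(a, b) ∈ ℤ^{m+n}` satisfying the stated system of inequalities. -/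
theorem s_arithmetic_dirichlet (S : Finset Pl) (hS : S.Nonempty) (m n : ℕ)
    (hm : 0 < m) (hn : 0 < n)
    (Ha : Fin m → ℝ) (hHa : ∀ j, 1 ≤ Ha j) (Hb : Fin n → ℝ) (hHb : ∀ i, 1 ≤ Hb i)
    (ψ : Pl → Fin n → ℝ) (hψ : ∀ v ∈ S, ∀ i : Fin n, ψ v i ∈ Set.Ioo (0 : ℝ) 1)
    (hprod : 1 ≤ (∏ v ∈ S, ∏ i : Fin n, psiTilde v (ψ v i)) * (∏ j, Ha j) *
      (if none ∈ S then 1 else ∏ i, Hb i))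
    (x : SpaceS S m n)
    (hx : ∀ (v : S) (i : Fin n) (j : Fin m), Pl.inZ v (x v i j)) :
    ∃ (a : Fin m → ℤ) (b : Fin n → ℤ), ¬(a = 0 ∧ b = 0) ∧
      (∀ (v : S) (i : Fin n), (v : Pl) ≠ none →
        Pl.absv v (linForm v (x v) a b i) ≤ ψ v i) ∧
      (∀ (v : S) (i : Fin n), (v : Pl) = none →
        Pl.absv v (linForm v (x v) a b i) < ψ v i) ∧
      (∀ j, |(a j : ℝ)| ≤ Ha j) ∧
      (none ∉ S → ∀ i, |(b i : ℝ)| ≤ Hb i) := by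
  classical
  let T : Finset Nat.Primes := Finset.eraseNone S
  let d : Nat.Primes → Fin n → ℕ := fun p i => (-Int.log p.1 (ψ (some p) i)).toNat
  have hd : ∀ p ∈ T, ∀ i, (p.1 : ℝ) ^ (-(d p i : ℤ)) = psiTilde (some p) (ψ (some p) i) := by
    intro p hp i
    have hψp := hψ _ (Finset.mem_eraseNone.1 hp) i
    have hlog : Int.log p.1 (ψ (some p) i) < 0 := by
      rw [← Int.lt_zpow_iff_log_lt p.2.one_lt hψp.1]
      simpa using hψp.2
    have : -(d p i : ℤ) = Int.log p.1 (ψ (some p) i) := by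
      simp only [d]; omega
    rw [this]; rfl
  let y : (p : Nat.Primes) → Fin n → Fin m → @PadicInt p.1 ⟨p.2⟩ := fun p i j =>
    if h : some p ∈ S then x ⟨some p, h⟩ i j else 0
  choose X hX using fun i j =>
    exists_int_forall_pow_dvd_sub T (fun p => d p i) (fun p => y p i j)
  let Q : Fin n → ℤ := fun i => ∏ p ∈ T, (p.1 : ℤ) ^ d p i
  have hQ : ∀ i, 0 < Q i := fun i =>
    Finset.prod_pos fun p _ => pow_pos (by exact_mod_cast p.2.pos) _
  have hQR : ∀ i, 0 < (Q i : ℝ) := fun i => by exact_mod_cast hQ i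
  have hQprod : (∏ i, (Q i : ℝ)) * ∏ p ∈ T, ∏ i, psiTilde (some p) (ψ (some p) i) = 1 := by
    rw [Finset.prod_comm, ← Finset.prod_mul_distrib]
    refine Finset.prod_eq_one fun i _ => ?_
    simp only [Q, Int.cast_prod, ← Finset.prod_mul_distrib]
    refine Finset.prod_eq_one fun p hp => ?_
    have : (p.1 : ℝ) ≠ 0 := by exact_mod_cast p.2.ne_zero
    rw [← hd p hp i]
    push_cast
    rw [zpow_neg, zpow_natCast, mul_inv_cancel₀ (pow_ne_zero _ this)]
  have hfloor : ∀ t : ℝ, t < (⌊t⌋ : ℝ) + 1 := Int.lt_floor_add_one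
  have hle_of_lt : ∀ (t : ℝ) (k : ℤ), |(k : ℝ)| < (⌊t⌋ : ℝ) + 1 → |(k : ℝ)| ≤ t := by
    intro t k hk
    have : |k| < ⌊t⌋ + 1 := by exact_mod_cast hk
    have := Int.le_floor.1 (Int.lt_add_one_iff.1 this)
    exact_mod_cast this
  have hA : ∏ j, Ha j < ∏ j, ((⌊Ha j⌋ : ℝ) + 1) :=
    Finset.prod_lt_prod (fun j _ => by linarith [hHa j]) (fun j _ => (hfloor _).le)
      ⟨⟨0, hm⟩, Finset.mem_univ _, hfloor _⟩
  have hApos : ∀ j, 0 < (⌊Ha j⌋ : ℝ) + 1 := fun j => by linarith [hHa j, hfloor (Ha j)]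
  have hQpos : 0 < ∏ i, (Q i : ℝ) := Finset.prod_pos fun i _ => hQR i
  have hHapos : 0 < ∏ j, Ha j := Finset.prod_pos fun j _ => by linarith [hHa j]
  have hTmap : ∏ v ∈ S.erase none, ∏ i, psiTilde v (ψ v i) =
      ∏ p ∈ T, ∏ i, psiTilde (some p) (ψ (some p) i) := by
    rw [← Finset.map_some_eraseNone, Finset.prod_map]
    rfl
  set P := ∏ p ∈ T, ∏ i, psiTilde (some p) (ψ (some p) i)
  obtain ⟨a, c, hac, ha, hreal, hint⟩ : ∃ (a : Fin m → ℤ) (c : Fin n → ℤ),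
      ¬(a = 0 ∧ c = 0) ∧ (∀ j, |(a j : ℝ)| < (⌊Ha j⌋ : ℝ) + 1) ∧
      (∀ h : none ∈ S, ∀ i, Pl.absv none (linForm none (x ⟨none, h⟩) a
        (fun i => ∑ j, a j * X i j - Q i * c i) i) < ψ none i) ∧
      (none ∉ S → ∀ i, |((∑ j, a j * X i j - Q i * c i : ℤ) : ℝ)| < (⌊Hb i⌋ : ℝ) + 1) := by
    by_cases hinf : none ∈ S
    · let x' : Fin n → Fin m → ℝ := x ⟨none, hinf⟩
      have hψpos : 0 < ∏ i, ψ none i := Finset.prod_pos fun i _ => (hψ _ hinf i).1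
      have hlt : ∏ i, (Q i : ℝ) < (∏ j, ((⌊Ha j⌋ : ℝ) + 1)) * ∏ i, ψ none i := by
        rw [if_pos hinf, mul_one, ← Finset.mul_prod_erase _ _ hinf, hTmap] at hprod
        change 1 ≤ (∏ i, ψ none i) * P * ∏ j, Ha j at hprod
        calc ∏ i, (Q i : ℝ) ≤ (∏ i, (Q i : ℝ)) * ((∏ i, ψ none i) * P * ∏ j, Ha j) :=
              le_mul_of_one_le_right hQpos.le hprod
          _ = (∏ i, (Q i : ℝ)) * P * ((∏ j, Ha j) * ∏ i, ψ none i) := by ring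
          _ = (∏ j, Ha j) * ∏ i, ψ none i := by rw [hQprod, one_mul]
          _ < _ := by gcongr
      obtain ⟨a, c, hac, ha, hc⟩ := exists_int_ne_zero_abs_lt_of_prod_lt
        (fun i j => x' i j - X i j) (fun i => (Q i : ℝ)) (ψ none) _ hQR
        (fun i => (hψ _ hinf i).1) hApos hlt
      refine ⟨a, c, hac, ha, fun _ i => ?_, fun h => absurd hinf h⟩
      change |(∑ j, (a j : ℝ) * x' i j) - ((∑ j, a j * X i j - Q i * c i : ℤ) : ℝ)| < ψ none i
      convert hc i using 2
      push_cast
      simp only [mul_sub, Finset.sum_sub_distrib]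
      ring
    · have hHbpos : 0 < ∏ i, Hb i := Finset.prod_pos fun i _ => by linarith [hHb i]
      have hB : ∏ i, Hb i ≤ ∏ i, ((⌊Hb i⌋ : ℝ) + 1) :=
        Finset.prod_le_prod (fun i _ => by linarith [hHb i]) fun i _ => (hfloor _).le
      have hlt : ∏ i, (Q i : ℝ) < (∏ j, ((⌊Ha j⌋ : ℝ) + 1)) * ∏ i, ((⌊Hb i⌋ : ℝ) + 1) := by
        rw [if_neg hinf, ← Finset.erase_eq_of_notMem hinf, hTmap] at hprod
        calc ∏ i, (Q i : ℝ) ≤ (∏ i, (Q i : ℝ)) * (P * (∏ j, Ha j) * ∏ i, Hb i) :=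
              le_mul_of_one_le_right hQpos.le hprod
          _ = (∏ i, (Q i : ℝ)) * P * ((∏ j, Ha j) * ∏ i, Hb i) := by ring
          _ = (∏ j, Ha j) * ∏ i, Hb i := by rw [hQprod, one_mul]
          _ < _ := mul_lt_mul hA hB hHbpos (hHapos.le.trans hA.le)
      obtain ⟨a, c, hac, ha, hc⟩ := exists_int_ne_zero_abs_lt_of_prod_lt
        (fun i j => -(X i j : ℝ)) (fun i => (Q i : ℝ)) (fun i => (⌊Hb i⌋ : ℝ) + 1) _ hQR
        (fun i => by linarith [hHb i, hfloor (Hb i)]) hApos hlt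
      refine ⟨a, c, hac, ha, fun h => absurd h hinf, fun _ i => ?_⟩
      rw [← abs_neg]
      convert hc i using 2
      push_cast
      simp only [mul_neg, Finset.sum_neg_distrib]
      ring
  refine ⟨a, fun i => ∑ j, a j * X i j - Q i * c i, ?_, ?_, ?_,
    fun j => hle_of_lt _ _ (ha j), fun h i => hle_of_lt _ _ (hint h i)⟩
  · rintro ⟨ha0, hb0⟩
    refine hac ⟨ha0, funext fun i => ?_⟩
    simpa [ha0, (hQ i).ne'] using congrFun hb0 i
  · rintro ⟨_ | p, hv⟩ i hne
    · exact absurd rfl hne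
    let : Fact p.1.Prime := ⟨p.2⟩
    have hpT : p ∈ T := Finset.mem_eraseNone.2 hv
    have hψp := hψ _ hv i
    let x' : Fin n → Fin m → ℤ_[p.1] := x ⟨some p, hv⟩
    have hy : ∀ i j, y p i j = x' i j := fun i j => dif_pos hv
    refine le_trans ?_ (Int.zpow_log_le_self p.2.one_lt hψp.1)
    refine le_trans ?_ (hd p hpT i).le
    change ‖(∑ j, (a j : ℤ_[p.1]) * x' i j) -
      ((∑ j, a j * X i j - Q i * c i : ℤ) : ℤ_[p.1])‖ ≤ _
    rw [PadicInt.norm_le_pow_iff_mem_span_pow, Ideal.mem_span_singleton]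
    have hsum : (p.1 : ℤ_[p.1]) ^ d p i ∣ ∑ j, (a j : ℤ_[p.1]) * (y p i j - (X i j : ℤ_[p.1])) :=
      Finset.dvd_sum fun j _ => (hX i j p hpT).mul_left _
    have hQdvd : (p.1 : ℤ_[p.1]) ^ d p i ∣ (Q i : ℤ_[p.1]) := by
      have := map_dvd (Int.castRingHom ℤ_[p.1])
        (Finset.dvd_prod_of_mem (fun p : Nat.Primes => (p.1 : ℤ) ^ d p i) hpT)
      simpa [Q] using this
    convert dvd_add hsum (hQdvd.mul_right (c i : ℤ_[p.1])) using 1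
    push_cast
    simp only [mul_sub, Finset.sum_sub_distrib, hy]
    ring
  · rintro ⟨_ | p, hv⟩ i hv0
    · exact hreal hv i
    · exact absurd hv0 (Option.some_ne_none p)

end
end

section
/- Let n, m ∈ ℕ and S a finite nonempty set of primes (so ∞ ∉ S). Let η = (1,…,1) ∈ ℝ^{m+n} and let τ = (τ_{i,ν})_{1≤i≤n, ν∈S} be positive weights with Σ_{i=1}^n Σ_{ν∈S} τ_{i,ν} = m+n and Σ_{ν∈S} τ_{i,ν} > 1 for every 1 ≤ i ≤ n. Then for any α > 0 the set W^α_{S,m,n}(τ,η) has μ_{S,m×n}-measure zero. -/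
open MeasureTheory

noncomputable section

/-- The underlying rational prime of a finite place (and `0` at the infinite place). -/
def Pl.nval : Pl → ℕ
  | none => 0
  | some p => p.1

/-- `W^δ_{S,m,n}(τ,η;H)`: points admitting a nonzero `(a,b)` solving the weighted
Dirichlet system at level `H` together with `min_{ν ∈ S^*} ‖a‖_ν ≤ H^{−δ}`. -/
def WDeltaH (S : Finset Pl) (m n : ℕ) (τ : Pl → Fin n → ℝ)
    (ηa : Fin m → ℝ) (ηb : Fin n → ℝ) (δ : ℝ) (H : ℕ) : Set (SpaceS S m n) :=
  {x | ∃ (a : Fin m → ℤ) (b : Fin n → ℤ), ¬(a = 0 ∧ b = 0) ∧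
    (∀ (v : S) (i : Fin n), (v : Pl) ≠ none →
      Pl.absv v (linForm v (x v) a b i) ≤ (Pl.nval v : ℝ) * (H : ℝ) ^ (-(τ v i))) ∧
    (∀ (v : S) (i : Fin n), (v : Pl) = none →
      Pl.absv v (linForm v (x v) a b i) < (H : ℝ) ^ (-(τ v i))) ∧
    (∀ j, |(a j : ℝ)| ≤ (H : ℝ) ^ ηa j) ∧
    (none ∉ S → ∀ i, |(b i : ℝ)| ≤ (H : ℝ) ^ ηb i) ∧
    ∃ v ∈ S, v ≠ none ∧ aNorm v a ≤ (H : ℝ) ^ (-δ)}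

/-- `W^δ_{S,m,n}(τ,η)`: points lying in `W^δ_{S,m,n}(τ,η;H)` for infinitely many
`H ∈ ℕ`. -/
def WDelta (S : Finset Pl) (m n : ℕ) (τ : Pl → Fin n → ℝ)
    (ηa : Fin m → ℝ) (ηb : Fin n → ℝ) (δ : ℝ) : Set (SpaceS S m n) :=
  {x | {H : ℕ | x ∈ WDeltaH S m n τ ηa ηb δ H}.Infinite}

section PadicInt

variable {p : ℕ} [Fact p.Prime]

theorem PadicInt.exists_pow_inv_le_norm_le {ε : ℝ} (hε : 0 < ε) :
    ∃ k : ℕ, ((p : ℝ) ^ k)⁻¹ ≤ ε ∧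
      ∀ y : ℤ_[p], ‖y‖ ≤ ε → ‖y‖ ≤ (p : ℝ) ^ (-k : ℤ) := by
  classical
  have hp : (1 : ℝ) < p := by exact_mod_cast (Fact.out : p.Prime).one_lt
  have hex : ∃ k : ℕ, ((p : ℝ) ^ k)⁻¹ ≤ ε := by
    obtain ⟨k, hk⟩ := pow_unbounded_of_one_lt ε⁻¹ hp
    exact ⟨k, inv_le_of_inv_le₀ hε hk.le⟩
  refine ⟨Nat.find hex, Nat.find_spec hex, fun y hy => ?_⟩
  rcases eq_or_ne y 0 with rfl | hy0
  · simp only [norm_zero]; positivity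
  rw [PadicInt.norm_le_pow_iff_le_valuation y hy0]
  refine Nat.find_min' hex ?_
  rwa [PadicInt.norm_eq_zpow_neg_valuation hy0, zpow_neg, zpow_natCast] at hy

theorem exists_maximal_pow_dvd {m : ℕ} (p : ℕ) (a : Fin m → ℤ) (k : ℕ) :
    ∃ e ≤ k, (∀ j, (p : ℤ) ^ e ∣ a j) ∧ (e = k ∨ ∃ j, ¬ (p : ℤ) ^ (e + 1) ∣ a j) := by
  induction k with
  | zero => exact ⟨0, le_rfl, by simp, Or.inl rfl⟩
  | succ k ih =>
    obtain ⟨e, hek, hdvd, h⟩ := ih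
    by_cases hall : ∀ j, (p : ℤ) ^ (k + 1) ∣ a j
    · exact ⟨k + 1, le_rfl, hall, Or.inl rfl⟩
    · push Not at hall
      rcases h with rfl | h
      · exact ⟨e, by omega, hdvd, Or.inr hall⟩
      · exact ⟨e, by omega, hdvd, Or.inr h⟩

theorem Int.pow_sub_dvd_of_pow_dvd_mul {c t : ℤ} {e k : ℕ} (hek : e ≤ k)
    (hc : (p : ℤ) ^ e ∣ c) (hc' : ¬ (p : ℤ) ^ (e + 1) ∣ c) (h : (p : ℤ) ^ k ∣ c * t) :
    (p : ℤ) ^ (k - e) ∣ t := by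
  have hp : Prime (p : ℤ) := Nat.prime_iff_prime_int.mp Fact.out
  obtain ⟨u, rfl⟩ := hc
  obtain ⟨r, rfl⟩ := Nat.exists_eq_add_of_le hek
  rw [pow_add, mul_assoc, mul_dvd_mul_iff_left (pow_ne_zero _ hp.ne_zero)] at h
  rw [Nat.add_sub_cancel_left]
  refine hp.pow_dvd_of_dvd_mul_left _ ?_ h
  rintro ⟨w, rfl⟩
  exact hc' ⟨w, by ring⟩

instance padicHaar.instIsProbabilityMeasure : IsProbabilityMeasure (padicHaar p) :=
  ⟨by simpa [padicHaar] using
    Measure.addHaarMeasure_self (K₀ := (⊤ : TopologicalSpace.PositiveCompacts ℤ_[p]))⟩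

instance padicHaar.instIsAddLeftInvariant : (padicHaar p).IsAddLeftInvariant := by
  unfold padicHaar; infer_instance

/-- The set of `y ∈ ℤ_p^m` with `|a·y - b|_p ≤ p^{-k}` is small: its translates in a direction
where `a` is not very divisible by `p` are disjoint. -/
theorem padicHaar_pi_linear_le {m : ℕ} (a : Fin m → ℤ) (b : ℤ) {e k : ℕ} (hek : e ≤ k)
    (hdvd : ∀ j, (p : ℤ) ^ e ∣ a j) (h : e = k ∨ ∃ j, ¬ (p : ℤ) ^ (e + 1) ∣ a j) :
    Measure.pi (fun _ : Fin m => padicHaar p)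
      {y | ‖(∑ j, (a j : ℤ_[p]) * y j) - (b : ℤ_[p])‖ ≤ (p : ℝ) ^ (-k : ℤ)}
      ≤ ((p : ENNReal) ^ (k - e))⁻¹ := by
  set A : Set (Fin m → ℤ_[p]) :=
    {y | ‖(∑ j, (a j : ℤ_[p]) * y j) - (b : ℤ_[p])‖ ≤ (p : ℝ) ^ (-k : ℤ)} with hA
  rcases h with rfl | ⟨j, hj⟩
  · simpa using prob_le_one
  have hclosed : IsClosed A := isClosed_le (by fun_prop) continuous_const
  have hmeas : MeasurableSet A := hclosed.measurableSet
  rw [← one_div, ENNReal.le_div_iff_mul_le (by left; simp [(Fact.out : p.Prime).ne_zero])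
    (by left; finiteness)]
  let shift : ℕ → Fin m → ℤ_[p] := fun t => Pi.single j (t : ℤ_[p])
  have hdisj : Set.PairwiseDisjoint (Finset.range (p ^ (k - e)) : Set ℕ)
      (fun t => (fun y => shift t + y) ⁻¹' A) := by
    intro t ht s hs hts
    refine Set.disjoint_left.mpr fun y hyt hys => hts ?_
    have hdiff := PadicInt.nonarchimedean
      ((∑ j, (a j : ℤ_[p]) * (shift t + y) j) - (b : ℤ_[p]))
      (-((∑ j, (a j : ℤ_[p]) * (shift s + y) j) - (b : ℤ_[p])))
    rw [norm_neg] at hdiff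
    replace hdiff := hdiff.trans (max_le hyt hys)
    have heq : ((∑ j, (a j : ℤ_[p]) * (shift t + y) j) - (b : ℤ_[p])) +
        (-((∑ j, (a j : ℤ_[p]) * (shift s + y) j) - (b : ℤ_[p]))) =
        ((a j * ((t : ℤ) - s) : ℤ) : ℤ_[p]) := by
      simp only [shift, Pi.add_apply, mul_add, Finset.sum_add_distrib, Pi.single_apply,
        mul_ite, mul_zero, Finset.sum_ite_eq', Finset.mem_univ, if_true]
      push_cast
      ring
    rw [heq, PadicInt.norm_int_le_pow_iff_dvd] at hdiff
    have hd := Int.pow_sub_dvd_of_pow_dvd_mul hek (hdvd j) hj (by exact_mod_cast hdiff)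
    have hmod : (s : ℤ) ≡ t [ZMOD ((p ^ (k - e) : ℕ) : ℤ)] := by
      rw [Int.modEq_iff_dvd]; exact_mod_cast hd
    have hmod' := Int.natCast_modEq_iff.mp hmod
    exact (Nat.ModEq.eq_of_lt_of_lt hmod' (by simpa using hs) (by simpa using ht)).symm
  have hsum := measure_biUnion_finset (μ := Measure.pi fun _ : Fin m => padicHaar p) hdisj
    (fun t _ => hmeas.preimage (measurable_const_add _))
  simp only [measure_preimage_add, Finset.sum_const, Finset.card_range, nsmul_eq_mul] at hsum
  rw [mul_comm]
  calc _ = _ := by rw [← Nat.cast_pow]; exact hsum.symm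
    _ ≤ 1 := prob_le_one

theorem pow_dvd_of_norm_linear_le {m : ℕ} {a : Fin m → ℤ} {b : ℤ} {e k : ℕ} (hek : e ≤ k)
    (hdvd : ∀ j, (p : ℤ) ^ e ∣ a j) {y : Fin m → ℤ_[p]}
    (hy : ‖(∑ j, (a j : ℤ_[p]) * y j) - (b : ℤ_[p])‖ ≤ (p : ℝ) ^ (-k : ℤ)) :
    (p : ℤ) ^ e ∣ b := by
  rw [PadicInt.norm_le_pow_iff_mem_span_pow, Ideal.mem_span_singleton] at hy
  have hb : (p : ℤ_[p]) ^ e ∣ (b : ℤ_[p]) := by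
    refine (dvd_sub_right (Finset.dvd_sum fun j _ => Dvd.dvd.mul_right ?_ _)).mp
      ((pow_dvd_pow _ hek).trans hy)
    exact_mod_cast map_dvd (Int.castRingHom ℤ_[p]) (hdvd j)
  rw [← Ideal.mem_span_singleton, ← PadicInt.norm_le_pow_iff_mem_span_pow,
    PadicInt.norm_int_le_pow_iff_dvd] at hb
  exact_mod_cast hb

end PadicInt

namespace Pl

theorem nval_prime {v : Pl} (hv : v ≠ none) : v.nval.Prime := by
  cases v with
  | none => exact absurd rfl hv
  | some p => exact p.2

theorem eq_of_nval_eq {v w : Pl} (hv : v ≠ none) (hw : w ≠ none) (h : v.nval = w.nval) : v = w := by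
  cases v with
  | none => exact absurd rfl hv
  | some p =>
    cases w with
    | none => exact absurd rfl hw
    | some q => exact congrArg some (Subtype.ext h)

theorem exists_pow_dvd_of_absv_le {v : Pl} (hv : v ≠ none) {ε : ℝ} (hε : 0 < ε) :
    ∃ k : ℕ, ((v.nval : ℝ) ^ k)⁻¹ ≤ ε ∧
      ∀ z : ℤ, absv v (z : carrier v) ≤ ε → (v.nval : ℤ) ^ k ∣ z := by
  cases v with
  | none => exact absurd rfl hv
  | some p =>
    have : Fact p.1.Prime := ⟨p.2⟩
    obtain ⟨k, hk, h⟩ := PadicInt.exists_pow_inv_le_norm_le (p := p.1) hε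
    refine ⟨k, hk, fun z hz => ?_⟩
    have := PadicInt.norm_int_le_pow_iff_dvd.mp (h (z : ℤ_[p.1]) hz)
    exact_mod_cast this

/-- For `e` maximal with `ν^e ∣ a` (up to the precision of `ε`), the inequality `|a·y - b|_ν ≤ ε`
forces `ν^e ∣ b`, and its solution set in `y` has measure at most `ν^e ε`. -/
theorem exists_linear_bound {m : ℕ} {v : Pl} (hv : v ≠ none) {ε : ℝ} (hε : 0 < ε)
    (a : Fin m → ℤ) :
    ∃ e : ℕ, (∀ j, (v.nval : ℤ) ^ e ∣ a j) ∧ ∀ b : ℤ,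
      (∀ y : Fin m → carrier v,
        absv v ((∑ j, (a j : carrier v) * y j) - (b : carrier v)) ≤ ε → (v.nval : ℤ) ^ e ∣ b) ∧
      Measure.pi (fun _ : Fin m => mu v)
        {y | absv v ((∑ j, (a j : carrier v) * y j) - (b : carrier v)) ≤ ε}
        ≤ (v.nval : ENNReal) ^ e * ENNReal.ofReal ε := by
  cases v with
  | none => exact absurd rfl hv
  | some p =>
    have : Fact p.1.Prime := ⟨p.2⟩
    have hp0 : (p.1 : ENNReal) ≠ 0 := by exact_mod_cast p.2.ne_zero
    obtain ⟨k, hk, h⟩ := PadicInt.exists_pow_inv_le_norm_le (p := p.1) hε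
    obtain ⟨e, hek, hdvd, hmax⟩ := exists_maximal_pow_dvd p.1 a k
    refine ⟨e, hdvd, fun b => ⟨fun y hy => pow_dvd_of_norm_linear_le (p := p.1) hek hdvd (h _ hy), ?_⟩⟩
    refine (measure_mono fun y hy => h _ hy).trans
      ((padicHaar_pi_linear_le a b hek hdvd hmax).trans ?_)
    have hε' : ((p.1 : ENNReal) ^ k)⁻¹ ≤ ENNReal.ofReal ε := by
      refine le_trans (le_of_eq ?_) (ENNReal.ofReal_le_ofReal hk)
      have hp : (0 : ℝ) < p.1 := by exact_mod_cast p.2.pos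
      rw [ENNReal.ofReal_inv_of_pos (by positivity), ENNReal.ofReal_pow hp.le,
        ENNReal.ofReal_natCast]
    calc ((p.1 : ENNReal) ^ (k - e))⁻¹
        = (p.1 : ENNReal) ^ e * ((p.1 : ENNReal) ^ k)⁻¹ := by
          obtain ⟨r, rfl⟩ := Nat.exists_eq_add_of_le hek
          rw [Nat.add_sub_cancel_left, pow_add, ENNReal.mul_inv (by simp [hp0]) (by simp [hp0]),
            ← mul_assoc, ENNReal.mul_inv_cancel (by simp [hp0]) (by finiteness), one_mul]
      _ ≤ _ := mul_le_mul_right hε' _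

theorem isCoprime_nval_pow {v w : Pl} (hv : v ≠ none) (hw : w ≠ none) (hvw : v ≠ w) (d e : ℕ) :
    IsCoprime ((v.nval : ℤ) ^ d) ((w.nval : ℤ) ^ e) := by
  refine IsCoprime.pow (Nat.isCoprime_iff_coprime.mpr ?_)
  exact (Nat.coprime_primes (nval_prime hv) (nval_prime hw)).mpr
    fun h => hvw (eq_of_nval_eq hv hw h)

end Pl

theorem prod_nval_pow_dvd {S : Finset Pl} (hfin : none ∉ S) (e : S → ℕ) {z : ℤ}
    (h : ∀ v : S, ((v : Pl).nval : ℤ) ^ e v ∣ z) :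
    ((∏ v : S, (v : Pl).nval ^ e v : ℕ) : ℤ) ∣ z := by
  push_cast
  refine Finset.prod_dvd_of_coprime (fun v _ w _ hvw => ?_) fun v _ => h v
  exact Pl.isCoprime_nval_pow (ne_of_mem_of_not_mem v.2 hfin) (ne_of_mem_of_not_mem w.2 hfin)
    (Subtype.coe_injective.ne hvw) _ _

/-- The multiples of `g` in `[-N, N]`. -/
def intMultiples (N g : ℕ) : Finset ℤ :=
  (Finset.Icc (-((N / g : ℕ) : ℤ)) ((N / g : ℕ) : ℤ)).image fun z => (g : ℤ) * z

theorem mem_intMultiples {N g : ℕ} (hg : 0 < g) {z : ℤ} :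
    z ∈ intMultiples N g ↔ (g : ℤ) ∣ z ∧ |z| ≤ N := by
  have key : ∀ w : ℤ, (-((N / g : ℕ) : ℤ) ≤ w ∧ w ≤ ((N / g : ℕ) : ℤ)) ↔ |(g : ℤ) * w| ≤ N := by
    intro w
    rw [← abs_le, abs_mul, Nat.abs_cast, Int.natCast_div,
      Int.le_ediv_iff_mul_le (by exact_mod_cast hg), mul_comm]
  simp only [intMultiples, Finset.mem_image, Finset.mem_Icc]
  constructor
  · rintro ⟨w, hw, rfl⟩
    exact ⟨dvd_mul_right _ _, (key w).mp hw⟩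
  · rintro ⟨⟨w, rfl⟩, hz⟩
    exact ⟨w, (key w).mpr hz, rfl⟩

theorem card_intMultiples_mul_le {N g : ℕ} (hgN : g ≤ N) :
    (intMultiples N g).card * g ≤ 3 * N := by
  have hcard : (intMultiples N g).card ≤ 2 * (N / g) + 1 := by
    refine Finset.card_image_le.trans ?_
    rw [Int.card_Icc]
    omega
  calc (intMultiples N g).card * g ≤ (2 * (N / g) + 1) * g := by gcongr
    _ = 2 * (N / g * g) + g := by ring
    _ ≤ 2 * N + g := by gcongr; exact Nat.div_mul_le_self N g
    _ ≤ 3 * N := by omega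

theorem le_of_dvd_of_abs_le {g N : ℕ} {z : ℤ} (hz : z ≠ 0) (hg : (g : ℤ) ∣ z) (hN : |z| ≤ N) :
    g ≤ N := by
  have h := Int.le_of_dvd (abs_pos.mpr hz) ((dvd_abs _ _).mpr hg)
  exact_mod_cast h.trans hN

/-- The nonzero vectors of `[-N, N]^m` all of whose coordinates are multiples of `q`. -/
def intMultipleVectors (m N q : ℕ) : Finset (Fin m → ℤ) :=
  (Fintype.piFinset fun _ => intMultiples N q).filter (· ≠ 0)

theorem mem_intMultipleVectors {m N q : ℕ} (hq : 0 < q) {a : Fin m → ℤ} :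
    a ∈ intMultipleVectors m N q ↔ (∀ j, (q : ℤ) ∣ a j ∧ |a j| ≤ N) ∧ a ≠ 0 := by
  simp [intMultipleVectors, mem_intMultiples hq]

theorem card_intMultipleVectors_mul_le {m N q : ℕ} (hq : 0 < q) :
    (intMultipleVectors m N q).card * q ^ m ≤ (3 * N) ^ m := by
  rcases (intMultipleVectors m N q).eq_empty_or_nonempty with h | ⟨a, ha⟩
  · simp [h]
  obtain ⟨hmem, hne⟩ := (mem_intMultipleVectors hq).mp ha
  obtain ⟨j, hj⟩ := Function.ne_iff.mp hne
  have hqN : q ≤ N := le_of_dvd_of_abs_le hj (hmem j).1 (hmem j).2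
  calc (intMultipleVectors m N q).card * q ^ m
      ≤ (intMultiples N q).card ^ m * q ^ m := by
        gcongr
        refine (Finset.card_filter_le _ _).trans ?_
        simp
    _ = ((intMultiples N q).card * q) ^ m := (mul_pow _ _ _).symm
    _ ≤ (3 * N) ^ m := Nat.pow_le_pow_left (card_intMultiples_mul_le hqN) m

theorem Pl.exists_dvd_of_aNorm_le {v : Pl} (hv : v ≠ none) {δ : ℝ} (hδ : 0 < δ) (m : ℕ) :
    ∃ q : ℕ, 0 < q ∧ (q : ℝ)⁻¹ ≤ δ ∧
      ∀ a : Fin m → ℤ, aNorm v a ≤ δ → ∀ j, (q : ℤ) ∣ a j := by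
  obtain ⟨k, hk, h⟩ := Pl.exists_pow_dvd_of_absv_le hv hδ
  refine ⟨v.nval ^ k, pow_pos (Pl.nval_prime hv).pos k, by exact_mod_cast hk, fun a ha j => ?_⟩
  have hne : (Finset.univ : Finset (Fin m)).Nonempty := ⟨j, Finset.mem_univ j⟩
  rw [aNorm, dif_pos hne, Finset.sup'_le_iff] at ha
  exact_mod_cast h (a j) (ha j (Finset.mem_univ j))

/-- The points solving the system of inequalities `|a·x_i - b_i|_ν ≤ ε_{i,ν}` in integer vectors of
sup-norm at most `N` with `a ≠ 0` and `min_ν ‖a‖_ν ≤ δ`. -/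
def levelSet (S : Finset Pl) (m n : ℕ) (ε : Pl → Fin n → ℝ) (δ : ℝ) (N : ℕ) :
    Set (SpaceS S m n) :=
  {x | ∃ (a : Fin m → ℤ) (b : Fin n → ℤ), a ≠ 0 ∧
    (∀ (v : S) (i : Fin n), Pl.absv v (linForm v (x v) a b i) ≤ ε v i) ∧
    (∀ j, |a j| ≤ N) ∧ (∀ i, |b i| ≤ N) ∧ ∃ v ∈ S, aNorm v a ≤ δ}

/-- For a fixed `a ≠ 0`, the contribution of all `b` to the measure of `levelSet`. -/
theorem muS_iUnion_solutions_le {S : Finset Pl} (hfin : none ∉ S) {m n : ℕ} {ε : Pl → Fin n → ℝ}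
    (hε : ∀ v ∈ S, ∀ i, 0 < ε v i) {N : ℕ} {a : Fin m → ℤ} (ha : a ≠ 0) (haN : ∀ j, |a j| ≤ N) :
    muS S m n {x | ∃ b : Fin n → ℤ, (∀ i, |b i| ≤ N) ∧
      ∀ (v : S) (i : Fin n), Pl.absv v (linForm v (x v) a b i) ≤ ε v i} ≤
      ∏ i : Fin n, (((3 * N : ℕ) : ENNReal) * ∏ v : S, ENNReal.ofReal (ε v i)) := by
  have hne : ∀ v : S, (v : Pl) ≠ none := fun v => ne_of_mem_of_not_mem v.2 hfin
  choose e hea he using fun (v : S) (i : Fin n) =>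
    Pl.exists_linear_bound (hne v) (hε v v.2 i) a
  let g : Fin n → ℕ := fun i => ∏ v : S, (v : Pl).nval ^ e v i
  have hgpos : ∀ i, 0 < g i := fun i =>
    Finset.prod_pos fun v _ => pow_pos (Pl.nval_prime (hne v)).pos _
  obtain ⟨j, hj⟩ := Function.ne_iff.mp ha
  have hgN : ∀ i, g i ≤ N := fun i =>
    le_of_dvd_of_abs_le hj (prod_nval_pow_dvd hfin (fun v => e v i) fun v => hea v i j) (haN j)
  let B : Finset (Fin n → ℤ) := Fintype.piFinset fun i => intMultiples N (g i)
  let X : (Fin n → ℤ) → Set (SpaceS S m n) := fun b =>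
    {x | ∀ (v : S) (i : Fin n), Pl.absv v (linForm v (x v) a b i) ≤ ε v i}
  have hcover : {x : SpaceS S m n | ∃ b : Fin n → ℤ, (∀ i, |b i| ≤ N) ∧
      ∀ (v : S) (i : Fin n), Pl.absv v (linForm v (x v) a b i) ≤ ε v i} ⊆ ⋃ b ∈ B, X b := by
    rintro x ⟨b, hbN, hx⟩
    refine Set.mem_biUnion (x := b) ?_ hx
    simp only [B, Finset.mem_coe, Fintype.mem_piFinset]
    exact fun i => (mem_intMultiples (hgpos i)).mpr
      ⟨prod_nval_pow_dvd hfin (fun v => e v i) fun v => (he v i (b i)).1 _ (hx v i), hbN i⟩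
  have hX : ∀ b, muS S m n (X b) ≤
      ∏ i : Fin n, ((g i : ENNReal) * ∏ v : S, ENNReal.ofReal (ε v i)) := by
    intro b
    have hXpi : X b = Set.pi Set.univ fun v : S => Set.pi Set.univ fun i : Fin n =>
        {y : Fin m → Pl.carrier v |
          Pl.absv v ((∑ j, (a j : Pl.carrier v) * y j) - (b i : Pl.carrier v)) ≤ ε v i} := by
      ext x
      exact ⟨fun h v _ i _ => h v i, fun h v i => h v trivial i trivial⟩
    calc muS S m n (X b)
        = ∏ v : S, ∏ i : Fin n, Measure.pi (fun _ : Fin m => Pl.mu v)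
            {y | Pl.absv v ((∑ j, (a j : Pl.carrier v) * y j) - (b i : Pl.carrier v))
              ≤ ε v i} := by
          rw [hXpi]
          refine (Measure.pi_pi _ _).trans (Finset.prod_congr rfl fun v _ => ?_)
          exact Measure.pi_pi _ _
      _ ≤ ∏ v : S, ∏ i : Fin n,
            (((v : Pl).nval : ENNReal) ^ e v i * ENNReal.ofReal (ε v i)) :=
          Finset.prod_le_prod' fun v _ => Finset.prod_le_prod' fun i _ => (he v i (b i)).2
      _ = _ := by
          rw [Finset.prod_comm]
          simp only [g, Finset.prod_mul_distrib, Nat.cast_prod, Nat.cast_pow]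
  calc _ ≤ ∑ b ∈ B, muS S m n (X b) := (measure_mono hcover).trans (measure_biUnion_finset_le _ _)
    _ ≤ ∑ _b ∈ B, ∏ i : Fin n, ((g i : ENNReal) * ∏ v : S, ENNReal.ofReal (ε v i)) :=
      Finset.sum_le_sum fun b _ => hX b
    _ = ∏ i : Fin n, (((intMultiples N (g i)).card * g i : ℕ) *
          ∏ v : S, ENNReal.ofReal (ε v i)) := by
      rw [Finset.sum_const, nsmul_eq_mul, Fintype.card_piFinset, Nat.cast_prod,
        ← Finset.prod_mul_distrib]
      exact Finset.prod_congr rfl fun i _ => by push_cast; ring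
    _ ≤ _ := Finset.prod_le_prod' fun i _ =>
      mul_le_mul_left (Nat.cast_le.mpr (card_intMultiples_mul_le (hgN i))) _

theorem muS_levelSet_le {S : Finset Pl} (hfin : none ∉ S) (m : ℕ) {n : ℕ} {ε : Pl → Fin n → ℝ}
    (hε : ∀ v ∈ S, ∀ i, 0 < ε v i) {δ : ℝ} (hδ : 0 < δ) (N : ℕ) :
    muS S m n (levelSet S m n ε δ N) ≤
      ENNReal.ofReal (S.card * (3 * N * δ) ^ m * ∏ i : Fin n, (3 * N * ∏ v ∈ S, ε v i)) := by
  have hne : ∀ v : S, (v : Pl) ≠ none := fun v => ne_of_mem_of_not_mem v.2 hfin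
  choose q hq hqδ hqa using fun v : S => Pl.exists_dvd_of_aNorm_le (hne v) hδ m
  let Y : (Fin m → ℤ) → Set (SpaceS S m n) := fun a => {x | ∃ b : Fin n → ℤ, (∀ i, |b i| ≤ N) ∧
    ∀ (v : S) (i : Fin n), Pl.absv v (linForm v (x v) a b i) ≤ ε v i}
  set P : ENNReal := ∏ i : Fin n, (((3 * N : ℕ) : ENNReal) * ∏ v : S, ENNReal.ofReal (ε v i))
  have hcover : levelSet S m n ε δ N ⊆
      ⋃ v ∈ (Finset.univ : Finset S), ⋃ a ∈ intMultipleVectors m N (q v), Y a := by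
    rintro x ⟨a, b, ha, hx, haN, hbN, v, hv, hva⟩
    refine Set.mem_biUnion (x := ⟨v, hv⟩) (Finset.mem_coe.mpr (Finset.mem_univ _))
      (Set.mem_biUnion (x := a) ?_ ⟨b, hbN, hx⟩)
    exact (mem_intMultipleVectors (hq _)).mpr ⟨fun j => ⟨hqa ⟨v, hv⟩ a hva j, haN j⟩, ha⟩
  have hcard : ∀ v : S, ((intMultipleVectors m N (q v)).card : ENNReal) ≤
      ENNReal.ofReal ((3 * N * δ) ^ m) := by
    intro v
    rw [← ENNReal.ofReal_natCast]
    refine ENNReal.ofReal_le_ofReal ?_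
    have hq0 : (0 : ℝ) < q v := by exact_mod_cast hq v
    have h : ((intMultipleVectors m N (q v)).card : ℝ) * (q v : ℝ) ^ m ≤ (3 * N) ^ m := by
      exact_mod_cast card_intMultipleVectors_mul_le (m := m) (N := N) (hq v)
    calc ((intMultipleVectors m N (q v)).card : ℝ)
        ≤ (3 * N) ^ m / (q v : ℝ) ^ m := (le_div_iff₀ (by positivity)).mpr h
      _ = (3 * N * (q v : ℝ)⁻¹) ^ m := by rw [← div_pow, div_eq_mul_inv]
      _ ≤ (3 * N * δ) ^ m := by gcongr; exact hqδ v
  have hPreal : P = ENNReal.ofReal (∏ i : Fin n, (3 * N * ∏ v ∈ S, ε v i)) := by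
    rw [ENNReal.ofReal_prod_of_nonneg fun i _ =>
      mul_nonneg (by positivity) (Finset.prod_nonneg fun v hv => (hε v hv i).le)]
    refine Finset.prod_congr rfl fun i _ => ?_
    rw [ENNReal.ofReal_mul (by positivity),
      ENNReal.ofReal_prod_of_nonneg fun v hv => (hε v hv i).le,
      Finset.prod_coe_sort S fun v => ENNReal.ofReal (ε v i)]
    congr 1
    rw [← ENNReal.ofReal_natCast]
    push_cast
    rfl
  calc muS S m n (levelSet S m n ε δ N)
      ≤ ∑ v : S, ∑ a ∈ intMultipleVectors m N (q v), muS S m n (Y a) :=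
        (measure_mono hcover).trans ((measure_biUnion_finset_le _ _).trans
          (Finset.sum_le_sum fun v _ => measure_biUnion_finset_le _ _))
    _ ≤ ∑ v : S, ∑ _a ∈ intMultipleVectors m N (q v), P := by
        refine Finset.sum_le_sum fun v _ => Finset.sum_le_sum fun a ha => ?_
        obtain ⟨hmem, ha0⟩ := (mem_intMultipleVectors (hq v)).mp ha
        exact muS_iUnion_solutions_le hfin hε ha0 fun j => (hmem j).2
    _ ≤ ∑ _v : S, ENNReal.ofReal ((3 * N * δ) ^ m) * P := by
        refine Finset.sum_le_sum fun v _ => ?_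
        rw [Finset.sum_const, nsmul_eq_mul]
        gcongr
        exact hcard v
    _ = _ := by
        rw [Finset.sum_const, nsmul_eq_mul, Finset.card_univ, Fintype.card_coe, hPreal,
          ENNReal.ofReal_mul (by positivity), ENNReal.ofReal_mul (by positivity),
          ENNReal.ofReal_natCast, ← mul_assoc]

/-- A nonzero integer `z` with `|z| ≤ N` cannot be small at all places of `S` simultaneously. -/
theorem one_le_mul_prod_of_absv_le {S : Finset Pl} (hfin : none ∉ S) {ε : Pl → ℝ}
    (hε : ∀ v ∈ S, 0 < ε v) {N : ℕ} {z : ℤ} (hz : z ≠ 0) (hzN : |z| ≤ N)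
    (h : ∀ v : S, Pl.absv v (z : Pl.carrier v) ≤ ε v) : 1 ≤ N * ∏ v ∈ S, ε v := by
  have hne : ∀ v : S, (v : Pl) ≠ none := fun v => ne_of_mem_of_not_mem v.2 hfin
  choose k hk hdvd using fun v : S => Pl.exists_pow_dvd_of_absv_le (hne v) (hε v v.2)
  have hD : ∏ v : S, (v : Pl).nval ^ k v ≤ N :=
    le_of_dvd_of_abs_le hz (prod_nval_pow_dvd hfin k fun v => hdvd v z (h v)) hzN
  have hpos : ∀ v : S, (0 : ℝ) < ((v : Pl).nval : ℝ) ^ k v := fun v =>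
    pow_pos (by exact_mod_cast (Pl.nval_prime (hne v)).pos) _
  calc (1 : ℝ) = (∏ v : S, ((v : Pl).nval : ℝ) ^ k v) *
        ∏ v : S, (((v : Pl).nval : ℝ) ^ k v)⁻¹ := by
        rw [← Finset.prod_mul_distrib]
        exact (Finset.prod_eq_one fun v _ => mul_inv_cancel₀ (hpos v).ne').symm
    _ ≤ N * ∏ v : S, ε v := by
        gcongr with v
        · exact_mod_cast hD
        · exact hk v
    _ = _ := by rw [Finset.prod_coe_sort S ε]

theorem tendsto_mul_rpow_prod_zero {S : Finset Pl} {t : Pl → ℝ} (ht : 1 < ∑ v ∈ S, t v) :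
    Filter.Tendsto (fun H : ℕ => (H : ℝ) * ∏ v ∈ S, ((v.nval : ℝ) * (H : ℝ) ^ (-(t v))))
      Filter.atTop (nhds 0) := by
  have h := ((tendsto_rpow_neg_atTop (sub_pos.mpr ht)).comp
    (tendsto_natCast_atTop_atTop (R := ℝ))).const_mul (∏ v ∈ S, (v.nval : ℝ))
  rw [mul_zero] at h
  refine h.congr' ?_
  filter_upwards [Filter.eventually_gt_atTop 0] with H hH
  have hH' : (0 : ℝ) < H := by exact_mod_cast hH
  rw [Function.comp_apply, Finset.prod_mul_distrib, ← Real.rpow_sum_of_pos hH',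
    Finset.sum_neg_distrib, neg_sub, sub_eq_add_neg, Real.rpow_add hH', Real.rpow_one]
  ring

theorem summable_levelSet_bound {S : Finset Pl} {m n : ℕ} (hm : 0 < m) {τ : Pl → Fin n → ℝ}
    (hτsum : ∑ v ∈ S, ∑ i : Fin n, τ v i = (m : ℝ) + n) {α : ℝ} (hα : 0 < α) :
    Summable fun k : ℕ => (S.card : ℝ) * (3 * (2 ^ (k + 1) : ℕ) * ((2 : ℝ) ^ k) ^ (-α)) ^ m *
      ∏ i : Fin n, (3 * (2 ^ (k + 1) : ℕ) *
        ∏ v ∈ S, ((v.nval : ℝ) * ((2 : ℝ) ^ k) ^ (-(τ v i)))) := by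
  have hr : ((2 : ℝ) ^ (-α)) ^ m < 1 :=
    pow_lt_one₀ (by positivity)
      (Real.rpow_lt_one_of_one_lt_of_neg one_lt_two (neg_lt_zero.mpr hα)) hm.ne'
  refine ((summable_geometric_of_lt_one (by positivity) hr).mul_left
    ((S.card : ℝ) * 6 ^ (m + n) * (∏ v ∈ S, (v.nval : ℝ)) ^ n)).congr fun k => ?_
  set X : ℝ := 2 ^ k with hX
  have hX0 : 0 < X := by positivity
  have hN : (3 * (2 ^ (k + 1) : ℕ) : ℝ) = 6 * X := by push_cast; rw [pow_succ]; ring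
  have hprod : ∏ i : Fin n, ∏ v ∈ S, X ^ (-(τ v i)) = (X ^ (m + n))⁻¹ := by
    simp_rw [← Real.rpow_sum_of_pos hX0]
    rw [Finset.sum_comm]
    simp_rw [Finset.sum_neg_distrib]
    rw [hτsum, Real.rpow_neg hX0.le]
    exact_mod_cast rfl
  have hα' : (((2 : ℝ) ^ (-α)) ^ m) ^ k = (X ^ (-α)) ^ m := by
    rw [← pow_mul, mul_comm m k, pow_mul, hX, ← Real.rpow_mul_natCast zero_le_two, mul_comm,
      Real.rpow_natCast_mul zero_le_two]
  simp_rw [hN, Finset.prod_mul_distrib, hprod, Finset.prod_const, Finset.card_univ,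
    Fintype.card_fin, hα']
  field_simp
  ring

/-- Proposition: for `S` a finite nonempty set of primes (`∞ ∉ S`), `η = (1,…,1)` and
positive weights `τ` with `∑_{i,ν} τ_{i,ν} = m + n` and `∑_ν τ_{i,ν} > 1` for all `i`,
the set `W^α_{S,m,n}(τ,η)` is `μ_{S,m×n}`-null for every `α > 0`. -/
theorem wDelta_measure_zero (S : Finset Pl) (hS : S.Nonempty) (hfin : none ∉ S)
    (m n : ℕ) (hm : 0 < m) (hn : 0 < n)
    (τ : Pl → Fin n → ℝ) (hτpos : ∀ v ∈ S, ∀ i : Fin n, 0 < τ v i)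
    (hτsum : ∑ v ∈ S, ∑ i : Fin n, τ v i = (m : ℝ) + n)
    (hτ1 : ∀ i : Fin n, 1 < ∑ v ∈ S, τ v i) :
    ∀ α : ℝ, 0 < α →
      muS S m n (WDelta S m n τ (fun _ => 1) (fun _ => 1) α) = 0 := by
  intro α hα
  let ε : ℕ → Pl → Fin n → ℝ := fun k v i => (v.nval : ℝ) * ((2 : ℝ) ^ k) ^ (-(τ v i))
  let E : ℕ → Set (SpaceS S m n) := fun k =>
    levelSet S m n (ε k) (((2 : ℝ) ^ k) ^ (-α)) (2 ^ (k + 1))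
  have hne : ∀ v ∈ S, v ≠ none := fun v hv => ne_of_mem_of_not_mem hv hfin
  have hnval : ∀ v ∈ S, (0 : ℝ) < v.nval := fun v hv => by
    exact_mod_cast (Pl.nval_prime (hne v hv)).pos
  have hE : ∀ k, muS S m n (E k) ≤ _ := fun k =>
    muS_levelSet_le hfin m (fun v hv i => mul_pos (hnval v hv) (by positivity)) (by positivity) _
  have hsum : ∑' k, muS S m n (E k) ≠ ⊤ :=
    ne_top_of_le_ne_top (summable_levelSet_bound hm hτsum hα).tsum_ofReal_ne_top
      (ENNReal.tsum_le_tsum hE)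
  refine measure_mono_null (fun x hx => ?_) (measure_setOfPred_frequently_eq_zero hsum)
  have hlarge : ∀ᶠ H : ℕ in Filter.atTop, ∀ i : Fin n,
      (H : ℝ) * ∏ v ∈ S, ((v.nval : ℝ) * (H : ℝ) ^ (-(τ v i))) < 1 :=
    Filter.eventually_all.mpr fun i =>
      (tendsto_mul_rpow_prod_zero (hτ1 i)).eventually_lt_const one_pos
  refine Filter.frequently_atTop.mpr fun K => ?_
  obtain ⟨H, ⟨a, b, hab, hlin, -, ha, hb, v₀, hv₀, -, hv₀a⟩, hH, hHK⟩ :=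
    ((Nat.frequently_atTop_iff_infinite.mpr hx).and_eventually
      (hlarge.and (Filter.eventually_ge_atTop (2 ^ K)))).exists
  have hH0 : 0 < H := lt_of_lt_of_le (by positivity) hHK
  have hH0' : (0 : ℝ) < H := by exact_mod_cast hH0
  simp only [Real.rpow_one] at ha hb
  have haH : ∀ j, |a j| ≤ (H : ℤ) := fun j => by exact_mod_cast ha j
  have hbH : ∀ i, |b i| ≤ (H : ℤ) := fun i => by exact_mod_cast hb hfin i
  have ha0 : a ≠ 0 := by
    rintro rfl
    obtain ⟨i, hi⟩ := Function.ne_iff.mp fun h : b = 0 => hab ⟨rfl, h⟩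
    refine (hH i).not_ge (one_le_mul_prod_of_absv_le hfin
      (fun v hv => mul_pos (hnval v hv) (by positivity)) (neg_ne_zero.mpr hi)
      (by rw [abs_neg]; exact hbH i) fun v => ?_)
    have h := hlin v i (hne v v.2)
    simpa [linForm] using h
  have hkH : 2 ^ Nat.log 2 H ≤ H := Nat.pow_log_le_self 2 hH0.ne'
  have hkH' : (2 : ℝ) ^ Nat.log 2 H ≤ H := by exact_mod_cast hkH
  have hHk : (H : ℤ) ≤ (2 ^ (Nat.log 2 H + 1) : ℕ) := by
    exact_mod_cast (Nat.lt_pow_succ_log_self one_lt_two H).le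
  have hanti : ∀ s : ℝ, 0 < s → (H : ℝ) ^ (-s) ≤ ((2 : ℝ) ^ Nat.log 2 H) ^ (-s) := fun s hs =>
    Real.rpow_le_rpow_of_nonpos (by positivity) hkH' (neg_nonpos.mpr hs.le)
  refine ⟨Nat.log 2 H, Nat.le_log_of_pow_le one_lt_two hHK, a, b, ha0, fun v i => ?_,
    fun j => (haH j).trans hHk, fun i => (hbH i).trans hHk, v₀, hv₀, hv₀a.trans (hanti α hα)⟩
  exact (hlin v i (hne v v.2)).trans
    (mul_le_mul_of_nonneg_left (hanti _ (hτpos v v.2 i)) (hnval v v.2).le)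

end
end

section
/- Let K = ∏_{j=1}^n K_j and μ be as in the rational self-similar fractal setup. Let Ψ = (ψ_1,…,ψ_n) be an n-tuple of non-negative functions ψ_i : ℕ → ℝ with ψ_i(q)/q → 0 as q → ∞ for each i. Let W_Int(K;Ψ) = {x ∈ K : |x_i − p_i/q| < ψ_i(q)/q for all 1 ≤ i ≤ n, for infinitely many rational points p/q = (p_1/q,…,p_n/q) ∈ ℚ^n ∩ K with q ∈ ℕ}, and Bad_Int(K;Ψ) = W_Int(K;Ψ) \ ⋂_{ℓ∈ℕ} W_Int(K;(1/ℓ)Ψ). Then μ(Bad_Int(K;Ψ)) = 0. -/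
open MeasureTheory Filter
open scoped ENNReal

/-- The set `W_Int(K; Ψ)` of points of `K = ∏ K_j` that are `Ψ`-approximable by
infinitely many rational points lying in `K`. -/
def WInt {n : ℕ} (K : Fin n → Set ℝ) (ψ : Fin n → ℕ → ℝ) : Set (Fin n → ℝ) :=
  {x | (∀ j, x j ∈ K j) ∧
    {pq : (Fin n → ℤ) × ℕ | 0 < pq.2 ∧ (∀ j, ((pq.1 j : ℝ) / pq.2) ∈ K j) ∧
      ∀ i, |x i - pq.1 i / pq.2| < ψ i pq.2 / pq.2}.Infinite}

/-- Being in infinitely many members of a countable family of measurable sets is measurable. -/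
lemma measurableSet_setOf_infinite {α ι : Type*} [MeasurableSpace α] [Countable ι]
    {U : ι → Set α} (hU : ∀ i, MeasurableSet (U i)) :
    MeasurableSet {x | {i | x ∈ U i}.Infinite} := by
  have h : {x | {i | x ∈ U i}.Infinite} = ⋂ F : Finset ι, ⋃ i, ⋃ _ : i ∉ F, U i := by
    ext x
    simp only [Set.mem_ofPred_eq, Set.mem_iInter, Set.mem_iUnion, exists_prop]
    constructor
    · intro hx F
      obtain ⟨i, hi, hiF⟩ := hx.exists_notMem_finset F
      exact ⟨i, hiF, hi⟩
    · intro hx hfin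
      obtain ⟨i, hiF, hi⟩ := hx hfin.toFinset
      exact hiF (by simpa using hi)
  rw [h]
  exact MeasurableSet.iInter fun F => MeasurableSet.iUnion fun i => MeasurableSet.iUnion fun _ =>
    hU i

/-- The iterated form of the self-similarity relation. -/
lemma exists_finset_selfSimilar_iterate {r : ℕ} (hr : 2 ≤ r) {D : Finset ℕ}
    (hD : ∀ a ∈ D, a ≤ r - 1) {μ : Measure ℝ}
    (hμss : ∀ A : Set ℝ, MeasurableSet A →
      μ A = ∑ a ∈ D, (D.card : ℝ≥0∞)⁻¹ * μ ((fun x : ℝ => (x + a) / r) ⁻¹' A)) (m : ℕ) :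
    ∃ E : Finset ℕ, ∀ A : Set ℝ, MeasurableSet A →
      μ A = ∑ k ∈ E, ((D.card : ℝ≥0∞)⁻¹) ^ m * μ ((fun x : ℝ => (x + k) / r ^ m) ⁻¹' A) := by
  induction m with
  | zero => exact ⟨{0}, fun A _ => by simp⟩
  | succ m ih =>
    obtain ⟨E, hE⟩ := ih
    refine ⟨(E ×ˢ D).image fun p => p.2 + r * p.1, fun A hA => ?_⟩
    have hr0 : (r : ℝ) ≠ 0 := by positivity
    rw [Finset.sum_image, Finset.sum_product, hE A hA]
    · refine Finset.sum_congr rfl fun k _ => ?_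
      rw [hμss _ (by measurability), Finset.mul_sum]
      refine Finset.sum_congr rfl fun a _ => ?_
      rw [← mul_assoc, ← pow_succ, ← Set.preimage_comp]
      congr 3
      ext x
      simp only [Function.comp_apply]
      push_cast
      field_simp
      ring
    · rintro ⟨k, a⟩ hp ⟨k', a'⟩ hp' h
      simp only [Finset.coe_product, Set.mem_prod, Finset.mem_coe] at hp hp' h
      have ha := hD a hp.2
      have ha' := hD a' hp'.2
      have h1 : (a + r * k) % r = (a' + r * k') % r := by rw [h]
      rw [Nat.add_mul_mod_self_left, Nat.add_mul_mod_self_left, Nat.mod_eq_of_lt (by omega),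
        Nat.mod_eq_of_lt (by omega)] at h1
      subst h1
      have h2 : r * k = r * k' := by omega
      rw [Nat.eq_of_mul_eq_mul_left (by omega) h2]

lemma card_filter_abs_sub_le (E : Finset ℕ) (c : ℝ) (R : ℕ) :
    (E.filter fun k : ℕ => |(k : ℝ) - c| ≤ R).card ≤ 2 * R + 1 := by
  have hsub : ((E.filter fun k : ℕ => |(k : ℝ) - c| ≤ R).image fun k : ℕ => (k : ℤ)) ⊆
      Finset.Icc ⌈c - R⌉ ⌊c + R⌋ := by
    intro z hz
    simp only [Finset.mem_image, Finset.mem_filter, abs_le] at hz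
    obtain ⟨k, ⟨-, h1, h2⟩, rfl⟩ := hz
    rw [Finset.mem_Icc, Int.ceil_le, Int.le_floor]
    push_cast
    constructor <;> linarith
  rw [← Finset.card_image_of_injective _ (Nat.cast_injective (R := ℤ))]
  refine (Finset.card_le_card hsub).trans ?_
  rw [Int.card_Icc]
  have h1 := Int.floor_le (c + R)
  have h2 := Int.le_ceil (c - R)
  have h3 : (⌊c + R⌋ : ℝ) - ⌈c - R⌉ ≤ 2 * R := by linarith
  have h4 : ⌊c + R⌋ - ⌈c - R⌉ ≤ 2 * (R : ℤ) := by exact_mod_cast h3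
  omega

section SelfSimilar

variable {r : ℕ} {D : Finset ℕ} {K : Set ℝ} {μ : Measure ℝ}

lemma selfSimilar_measure_closedBall_ge (hr : 2 ≤ r)
    (hKsub : K ⊆ Set.Icc 0 1)
    (hKattr : K = ⋃ a ∈ D, (fun x : ℝ => (x + a) / r) '' K) (hμK : μ K = 1)
    (hμss : ∀ A : Set ℝ, MeasurableSet A →
      μ A = ∑ a ∈ D, (D.card : ℝ≥0∞)⁻¹ * μ ((fun x : ℝ => (x + a) / r) ⁻¹' A)) (m : ℕ) :
    ∀ x ∈ K, ((D.card : ℝ≥0∞)⁻¹) ^ m ≤ μ (Metric.closedBall x ((r : ℝ)⁻¹ ^ m)) := by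
  induction m with
  | zero =>
    intro x hx
    rw [pow_zero, pow_zero, ← hμK]
    refine measure_mono fun y hy => ?_
    have h1 := hKsub hx
    have h2 := hKsub hy
    rw [Metric.mem_closedBall, Real.dist_eq, abs_le]
    constructor <;> linarith [h1.1, h1.2, h2.1, h2.2]
  | succ m ih =>
    intro x hx
    have hr0 : (0 : ℝ) < r := by positivity
    rw [hKattr] at hx
    simp only [Set.mem_iUnion, Set.mem_image] at hx
    obtain ⟨a, ha, y, hy, rfl⟩ := hx
    rw [hμss _ Metric.isClosed_closedBall.measurableSet]
    refine le_trans ?_ (Finset.single_le_sum (fun _ _ => zero_le) ha)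
    rw [pow_succ']
    gcongr
    refine (ih y hy).trans (measure_mono fun z hz => ?_)
    rw [Metric.mem_closedBall, Real.dist_eq] at hz
    rw [Set.mem_preimage, Metric.mem_closedBall, Real.dist_eq]
    have : (z + a) / r - (y + a) / r = (r : ℝ)⁻¹ * (z - y) := by field_simp; ring
    rw [this, abs_mul, abs_of_pos (by positivity), pow_succ']
    gcongr

lemma selfSimilar_measure_closedBall_le (hr : 2 ≤ r) (hD : ∀ a ∈ D, a ≤ r - 1)
    [IsProbabilityMeasure μ] (hKmeas : MeasurableSet K)
    (hKsub : K ⊆ Set.Icc 0 1) (hμK : μ K = 1)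
    (hμss : ∀ A : Set ℝ, MeasurableSet A →
      μ A = ∑ a ∈ D, (D.card : ℝ≥0∞)⁻¹ * μ ((fun x : ℝ => (x + a) / r) ⁻¹' A))
    (m R : ℕ) (x : ℝ) :
    μ (Metric.closedBall x (R * (r : ℝ)⁻¹ ^ m)) ≤
      (2 * (R + 1) + 1 : ℕ) * ((D.card : ℝ≥0∞)⁻¹) ^ m := by
  have hr0 : (0 : ℝ) < r := by positivity
  obtain ⟨E, hE⟩ := exists_finset_selfSimilar_iterate hr hD hμss m
  rw [hE _ Metric.isClosed_closedBall.measurableSet]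
  set F := E.filter fun k : ℕ => |(k : ℝ) - x * r ^ m| ≤ (R + 1 : ℕ)
  rw [← Finset.sum_subset (Finset.filter_subset _ E : F ⊆ E)]
  · calc _ ≤ ∑ k ∈ F, ((D.card : ℝ≥0∞)⁻¹) ^ m :=
          Finset.sum_le_sum fun k _ => mul_le_of_le_one_right zero_le prob_le_one
      _ = F.card * ((D.card : ℝ≥0∞)⁻¹) ^ m := by rw [Finset.sum_const, nsmul_eq_mul]
      _ ≤ _ := by
          gcongr
          exact card_filter_abs_sub_le E _ _
  · intro k hk hkF
    have hKc : μ Kᶜ = 0 := (prob_compl_eq_zero_iff hKmeas).2 hμK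
    rw [measure_mono_null _ hKc, mul_zero]
    intro y hy hyK
    apply hkF
    rw [Finset.mem_filter]
    refine ⟨hk, ?_⟩
    have hyI := hKsub hyK
    rw [Set.mem_preimage, Metric.mem_closedBall, Real.dist_eq] at hy
    have hrm : (0 : ℝ) < r ^ m := by positivity
    have h1 : |y + k - x * r ^ m| ≤ R := by
      have : y + k - x * r ^ m = ((y + k) / r ^ m - x) * r ^ m := by field_simp
      rw [this, abs_mul, abs_of_pos hrm]
      calc _ ≤ R * (r : ℝ)⁻¹ ^ m * r ^ m := by gcongr
        _ = R := by rw [inv_pow]; field_simp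
    push_cast
    rw [abs_le] at h1 ⊢
    constructor <;> linarith [h1.1, h1.2, hyI.1, hyI.2]

lemma comap_subtype_closedBall (hKmeas : MeasurableSet K)
    [IsProbabilityMeasure μ] (hμK : μ K = 1) (x : K) (ε : ℝ) :
    μ.comap (Subtype.val : K → ℝ) (Metric.closedBall x ε) = μ (Metric.closedBall (x : ℝ) ε) := by
  have hKc : μ Kᶜ = 0 := (prob_compl_eq_zero_iff hKmeas).2 hμK
  rw [comap_subtype_coe_apply hKmeas]
  have : (Subtype.val '' Metric.closedBall x ε : Set ℝ) = Metric.closedBall (x : ℝ) ε ∩ K := by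
    ext y
    simp
  rw [this, measure_inter_conull hKc]

/-- The self-similar measure is doubling on its attractor. -/
lemma selfSimilar_isUnifLocDoublingMeasure (hr : 2 ≤ r) (hDne : D.Nonempty)
    (hD : ∀ a ∈ D, a ≤ r - 1) [IsProbabilityMeasure μ] (hKmeas : MeasurableSet K)
    (hKsub : K ⊆ Set.Icc 0 1)
    (hKattr : K = ⋃ a ∈ D, (fun x : ℝ => (x + a) / r) '' K) (hμK : μ K = 1)
    (hμss : ∀ A : Set ℝ, MeasurableSet A →
      μ A = ∑ a ∈ D, (D.card : ℝ≥0∞)⁻¹ * μ ((fun x : ℝ => (x + a) / r) ⁻¹' A)) :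
    IsUnifLocDoublingMeasure (μ.comap (Subtype.val : K → ℝ)) := by
  have hr1 : (1 : ℝ) < r := by exact_mod_cast hr
  have hcard : (D.card : ℝ≥0∞) ≠ 0 := by simpa using hDne.ne_empty
  refine ⟨⟨7 * (D.card : NNReal), ?_⟩⟩
  filter_upwards [Ioo_mem_nhdsGT (zero_lt_one (α := ℝ))] with ε hε x
  obtain ⟨m, hm1, hm2⟩ := exists_nat_pow_near_of_lt_one hε.1 hε.2.le
    (inv_pos.2 (zero_lt_one.trans hr1)) (inv_lt_one_of_one_lt₀ hr1)
  rw [comap_subtype_closedBall hKmeas hμK, comap_subtype_closedBall hKmeas hμK]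
  calc μ (Metric.closedBall (x : ℝ) (2 * ε))
      ≤ μ (Metric.closedBall (x : ℝ) ((2 : ℕ) * (r : ℝ)⁻¹ ^ m)) := by
        refine measure_mono (Metric.closedBall_subset_closedBall ?_)
        push_cast
        linarith
    _ ≤ (2 * (2 + 1) + 1 : ℕ) * ((D.card : ℝ≥0∞)⁻¹) ^ m :=
        selfSimilar_measure_closedBall_le hr hD hKmeas hKsub hμK hμss m 2 x
    _ = 7 * D.card * ((D.card : ℝ≥0∞)⁻¹) ^ (m + 1) := by
        rw [pow_succ', mul_assoc, ← mul_assoc (D.card : ℝ≥0∞),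
          ENNReal.mul_inv_cancel hcard (ENNReal.natCast_ne_top _), one_mul]
        norm_num
    _ ≤ 7 * D.card * μ (Metric.closedBall (x : ℝ) ε) := by
        gcongr
        exact (selfSimilar_measure_closedBall_ge hr hKsub hKattr hμK hμss (m + 1) x x.2).trans
          (measure_mono (Metric.closedBall_subset_closedBall hm1.le))
    _ = _ := by push_cast; rfl

end SelfSimilar

/-- Cassels' scaling lemma: shrinking the radii by a constant factor does not change, up to a null
set, the points lying in infinitely many balls. -/
lemma ae_infinite_of_infinite_mul {K : Set ℝ} (hKmeas : MeasurableSet K) {μ : Measure ℝ}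
    [IsProbabilityMeasure μ] (hμK : μ K = 1)
    (hdbl : IsUnifLocDoublingMeasure (μ.comap (Subtype.val : K → ℝ)))
    {ι : Type*} [Countable ι] (c : ι → K) (ρ : ι → ℝ) (hρ : Tendsto ρ cofinite (nhds 0))
    {M : ℝ} (hM : 0 < M) :
    ∀ᵐ x ∂μ, {i | |x - (c i : ℝ)| < ρ i}.Infinite →
      {i | |x - (c i : ℝ)| < M * ρ i}.Infinite := by
  rcases finite_or_infinite ι with hι | hι
  · exact Eventually.of_forall fun x hx => absurd (Set.toFinite _) hx
  obtain ⟨hden⟩ := nonempty_denumerable ι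
  let e : ℕ ≃ ι := (Denumerable.eqv ι).symm
  have hfin : IsFiniteMeasure (μ.comap (Subtype.val : K → ℝ)) := by
    constructor
    rw [comap_subtype_coe_apply hKmeas]
    exact measure_lt_top _ _
  have key := blimsup_thickening_mul_ae_eq (μ.comap (Subtype.val : K → ℝ)) (fun _ => True)
    (fun i => {c (e i)}) hM (fun i => ρ (e i))
    (by
      rw [← Nat.cofinite_eq_atTop]
      exact hρ.comp e.injective.tendsto_cofinite)
  simp only [blimsup_true, ← Nat.cofinite_eq_atTop, cofinite.limsup_set_eq,
    Metric.thickening_singleton] at key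
  have hiff : ∀ (x : K) (s : ι → ℝ), {i : ℕ | x ∈ Metric.ball (c (e i)) (s (e i))}.Infinite ↔
      {i | |(x : ℝ) - (c i : ℝ)| < s i}.Infinite := by
    intro x s
    have : {i : ℕ | x ∈ Metric.ball (c (e i)) (s (e i))} = e ⁻¹' {i | |(x : ℝ) - (c i : ℝ)| < s i} := by
      ext i
      simp [Subtype.dist_eq, Real.dist_eq]
    rw [this, ← e.image_symm_eq_preimage, Set.infinite_image_iff e.symm.injective.injOn]
  have hrestrict : μ.restrict K = μ :=
    Measure.restrict_eq_self_of_ae_mem ((prob_compl_eq_zero_iff hKmeas).2 hμK)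
  rw [← hrestrict, ← map_comap_subtype_coe hKmeas,
    (MeasurableEmbedding.subtype_coe hKmeas).ae_map_iff]
  filter_upwards [key.mem_iff] with x hx hinf
  exact (hiff x fun i => M * ρ i).1 (hx.2 ((hiff x ρ).2 hinf))

/-- A measurable set all of whose sections in a fixed coordinate direction are null is null. -/
lemma pi_measure_zero_of_sections {n : ℕ} (μ : Fin n → Measure ℝ) [∀ j, SigmaFinite (μ j)]
    {S : Set (Fin n → ℝ)} (hS : MeasurableSet S) (j : Fin n)
    (h : ∀ x, ∀ᵐ t ∂μ j, Function.update x j t ∉ S) : Measure.pi μ S = 0 := by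
  rw [← lintegral_indicator_one hS]
  have hf : Measurable (S.indicator (1 : (Fin n → ℝ) → ℝ≥0∞)) := measurable_one.indicator hS
  rw [lintegral_eq_lmarginal_univ (fun _ => 0), lmarginal_erase' _ hf (Finset.mem_univ j)]
  have : (fun x => ∫⁻ t, S.indicator (1 : (Fin n → ℝ) → ℝ≥0∞) (Function.update x j t) ∂μ j) =
      fun _ => 0 := by
    ext x
    refine (lintegral_eq_zero_iff (hf.comp (measurable_update x))).2 ?_
    filter_upwards [h x] with t ht
    simp [ht]
  rw [this]
  simp [lmarginal]

lemma measurableSet_WInt {n : ℕ} {K : Fin n → Set ℝ} (hK : ∀ j, MeasurableSet (K j))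
    (ψ : Fin n → ℕ → ℝ) : MeasurableSet (WInt K ψ) := by
  have h1 : MeasurableSet {x : Fin n → ℝ | ∀ j, x j ∈ K j} := by
    simp only [Set.ofPred_forall]
    exact MeasurableSet.iInter fun j => measurable_pi_apply j (hK j)
  refine h1.inter (measurableSet_setOf_infinite (U := fun pq : (Fin n → ℤ) × ℕ =>
    {x : Fin n → ℝ | 0 < pq.2 ∧ (∀ j, ((pq.1 j : ℝ) / pq.2) ∈ K j) ∧
      ∀ i, |x i - pq.1 i / pq.2| < ψ i pq.2 / pq.2}) fun pq => ?_)
  have h2 : MeasurableSet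
      {x : Fin n → ℝ | ∀ i, |x i - pq.1 i / pq.2| < ψ i pq.2 / pq.2} := by
    simp only [Set.ofPred_forall]
    exact MeasurableSet.iInter fun i => measurableSet_lt (by fun_prop) measurable_const
  exact (MeasurableSet.const _).inter ((MeasurableSet.const _).inter h2)

/-- Along the rational points of a bounded set, the denominators tend to infinity. -/
lemma tendsto_div_cofinite_rationalPoints {n : ℕ} {K : Fin n → Set ℝ}
    (hKsub : ∀ j, K j ⊆ Set.Icc 0 1) {φ : ℕ → ℝ}
    (hφ : Tendsto (fun q : ℕ => φ q / q) atTop (nhds 0)) (P : Set ((Fin n → ℤ) × ℕ))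
    (hP : ∀ pq ∈ P, 0 < pq.2 ∧ ∀ j, ((pq.1 j : ℝ) / pq.2) ∈ K j) :
    Tendsto (fun pq : P => φ pq.1.2 / pq.1.2) cofinite (nhds 0) := by
  refine hφ.comp (f := fun pq : P => pq.1.2) ?_
  rw [← Nat.cofinite_eq_atTop]
  refine Tendsto.cofinite_of_finite_preimage_singleton fun q => ?_
  have hfin : ((Set.univ.pi fun _ : Fin n => Set.Icc (0 : ℤ) q) ×ˢ {q}).Finite :=
    (Set.Finite.pi fun _ => Set.finite_Icc _ _).prod (Set.finite_singleton q)
  refine Set.Finite.of_finite_image (f := Subtype.val) (hfin.subset ?_) Subtype.val_injective.injOn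
  rintro _ ⟨⟨pq, hpq⟩, rfl, rfl⟩
  obtain ⟨hq, hK⟩ := hP pq hpq
  refine ⟨fun j _ => ?_, rfl⟩
  have hj := hKsub j (hK j)
  have hq' : (0 : ℝ) < pq.2 := by exact_mod_cast hq
  rw [Set.mem_Icc, le_div_iff₀ hq', div_le_one hq', zero_mul] at hj
  exact ⟨by exact_mod_cast hj.1, by exact_mod_cast hj.2⟩

/-- Scaling one coordinate of the approximating function changes `WInt` by a null set. -/
lemma pi_measure_WInt_diff_scale_coord {n : ℕ} {K : Fin n → Set ℝ}
    (hKmeas : ∀ j, MeasurableSet (K j)) (hKsub : ∀ j, K j ⊆ Set.Icc 0 1)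
    (μ : Fin n → Measure ℝ) [∀ j, IsProbabilityMeasure (μ j)] (hμK : ∀ j, μ j (K j) = 1)
    (hdbl : ∀ j, IsUnifLocDoublingMeasure ((μ j).comap (Subtype.val : K j → ℝ)))
    (φ φ' : Fin n → ℕ → ℝ) (j : Fin n)
    (hφ : Tendsto (fun q : ℕ => φ j q / q) atTop (nhds 0)) {M : ℝ} (hM : 0 < M)
    (hj : ∀ q, φ' j q = M * φ j q) (hne : ∀ i ≠ j, φ' i = φ i) :
    Measure.pi μ (WInt K φ \ WInt K φ') = 0 := by
  refine pi_measure_zero_of_sections μ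
    ((measurableSet_WInt hKmeas φ).diff (measurableSet_WInt hKmeas φ')) j fun x => ?_
  let P : Set ((Fin n → ℤ) × ℕ) := {pq | (0 < pq.2 ∧ ∀ j, ((pq.1 j : ℝ) / pq.2) ∈ K j) ∧
    ∀ i ≠ j, |x i - pq.1 i / pq.2| < φ i pq.2 / pq.2}
  have hiff : ∀ (θ : Fin n → ℕ → ℝ) (t : ℝ), (∀ i ≠ j, θ i = φ i) →
      ({pq : (Fin n → ℤ) × ℕ | 0 < pq.2 ∧ (∀ j, ((pq.1 j : ℝ) / pq.2) ∈ K j) ∧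
        ∀ i, |Function.update x j t i - pq.1 i / pq.2| < θ i pq.2 / pq.2}.Infinite ↔
      {pq : P | |t - pq.1.1 j / pq.1.2| < θ j pq.1.2 / pq.1.2}.Infinite) := by
    intro θ t hθ
    rw [← Set.infinite_image_iff (f := (Subtype.val : P → _)) Subtype.val_injective.injOn]
    congr! 1
    ext pq
    constructor
    · rintro ⟨h1, h2, h3⟩
      have h4 : |t - pq.1 j / pq.2| < θ j pq.2 / pq.2 := by simpa using h3 j
      refine ⟨⟨pq, ⟨h1, h2⟩, fun i hi => ?_⟩, h4, rfl⟩
      simpa [hi, hθ i hi] using h3 i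
    · rintro ⟨⟨pq, ⟨h1, h2⟩, h3⟩, h4, rfl⟩
      refine ⟨h1, h2, fun i => ?_⟩
      rcases eq_or_ne i j with rfl | hi
      · rw [Function.update_self]
        exact h4
      · simpa [hi, hθ i hi] using h3 i hi
  have key := ae_infinite_of_infinite_mul (hKmeas j) (hμK j) (hdbl j)
    (fun pq : P => ⟨(pq.1.1 j : ℝ) / pq.1.2, pq.2.1.2 j⟩) (fun pq : P => φ j pq.1.2 / pq.1.2)
    (tendsto_div_cofinite_rationalPoints hKsub hφ P fun pq hpq => hpq.1) hM
  filter_upwards [key] with t ht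
  rintro ⟨⟨hK, hinf⟩, hnot⟩
  refine hnot ⟨hK, (hiff φ' t hne).2 ?_⟩
  have := ht ((hiff φ t fun _ _ => rfl).1 hinf)
  simpa only [hj, mul_div_assoc] using this

/-- Theorem: for the self-similar fractal `K = ∏ K_j` with canonical self-similar measure
`μ = μ₁ × ⋯ × μ_n`, and any `n`-tuple `Ψ` of non-negative approximation functions with
`ψ_i(q)/q → 0`, the set `Bad_Int(K;Ψ) = W_Int(K;Ψ) \ ⋂_ℓ W_Int(K;(1/ℓ)Ψ)` of
intrinsically badly approximable points is `μ`-null. -/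
theorem badInt_measure_zero (r n : ℕ) (hr : 2 ≤ r) (hn : 0 < n)
    (D : Fin n → Finset ℕ) (hDne : ∀ j, (D j).Nonempty) (hD : ∀ j, ∀ a ∈ D j, a ≤ r - 1)
    (K : Fin n → Set ℝ)
    (hKcomp : ∀ j, IsCompact (K j)) (hKne : ∀ j, (K j).Nonempty)
    (hKsub : ∀ j, K j ⊆ Set.Icc 0 1)
    (hKattr : ∀ j, K j = ⋃ a ∈ D j, (fun x : ℝ => (x + a) / r) '' K j)
    (μ : Fin n → Measure ℝ) [∀ j, IsProbabilityMeasure (μ j)]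
    (hμK : ∀ j, μ j (K j) = 1)
    (hμss : ∀ j, ∀ A : Set ℝ, MeasurableSet A →
      μ j A = ∑ a ∈ D j, ((D j).card : ℝ≥0∞)⁻¹ * μ j ((fun x : ℝ => (x + a) / r) ⁻¹' A))
    (ψ : Fin n → ℕ → ℝ) (hψ0 : ∀ i q, 0 ≤ ψ i q)
    (hψ : ∀ i, Tendsto (fun q : ℕ => ψ i q / q) atTop (nhds 0)) :
    Measure.pi μ (WInt K ψ \ ⋂ l : ℕ, WInt K fun i q => ψ i q / (l + 1)) = 0 := by
  have hKmeas : ∀ j, MeasurableSet (K j) := fun j => (hKcomp j).measurableSet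
  have hdbl := fun j => selfSimilar_isUnifLocDoublingMeasure hr (hDne j) (hD j) (hKmeas j)
    (hKsub j) (hKattr j) (hμK j) (hμss j)
  rw [Set.sdiff_iInter, measure_iUnion_null_iff]
  intro l
  have hscale : ∀ s : Finset (Fin n), Measure.pi μ
      (WInt K ψ \ WInt K fun i q => if i ∈ s then ψ i q / (l + 1) else ψ i q) = 0 := by
    intro s
    induction s using Finset.induction_on with
    | empty => simp
    | insert j s hjs ih =>
      refine measure_mono_null ?_ (measure_union_null ih
        (pi_measure_WInt_diff_scale_coord hKmeas hKsub μ hμK hdbl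
          (fun i q => if i ∈ s then ψ i q / (l + 1) else ψ i q)
          (fun i q => if i ∈ insert j s then ψ i q / (l + 1) else ψ i q) j ?_
          (M := ((l : ℝ) + 1)⁻¹) (by positivity) ?_ ?_))
      · intro x hx
        by_cases h : x ∈ WInt K fun i q => if i ∈ s then ψ i q / (l + 1) else ψ i q
        · exact Or.inr ⟨h, hx.2⟩
        · exact Or.inl ⟨hx.1, h⟩
      · simpa [hjs] using hψ j
      · intro q
        simp [hjs, div_eq_inv_mul]
      · intro i hi
        simp [hi]
  simpa using hscale Finset.univ
end
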